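/- arXiv:1504.07674 — 5 statements merged into one kernel-verified Lean document; each statement's English description precedes it below -/
import Mathlib

section
/- Fix ρ > 0 and integers N ≥ 1 and M ≥ N, and let f(z) = Σ_{j=0}^{N−1} c_j z^j + c' z^M be a polynomial with real coefficients. Then the following are equivalent: (1) f[A] ∈ 𝒫_N(ℂ) for every A ∈ 𝒫_N(D̄(0,ρ)); (2) either c_0, …, c_{N−1}, c' are all ≥ 0, or c_0, …, c_{N−1} > 0 and c' ≥ −𝒞(c; z^M; N, ρ)^{−1}; (3) f[A] is positive semidefinite for every A ∈ 𝒫_N^1((0,ρ)). -/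
open scoped ComplexOrder

noncomputable section

/-- The `k`-th Hadamard (entrywise) power of a matrix. -/
def hadPow {N : ℕ} (A : Matrix (Fin N) (Fin N) ℂ) (k : ℕ) : Matrix (Fin N) (Fin N) ℂ :=
  Matrix.of fun i j => A i j ^ k

/-- The constant `𝒞(c; z^M; N, ρ)`. -/
def CC (N : ℕ) (c : Fin N → ℝ) (M : ℕ) (ρ : ℝ) : ℝ :=
  ∑ j : Fin N, (M.choose j : ℝ) ^ 2 * ((M - (j : ℕ) - 1).choose (N - (j : ℕ) - 1) : ℝ) ^ 2
    * ρ ^ (M - (j : ℕ)) / c j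

/-- For `n ≥ 1`, the coefficient of `x ^ k` in the remainder of `x ^ (n + m - 1)` modulo
`∏ i < n, (x - u i)`. -/
def monomialRem {R : Type*} [CommRing R] (u : ℕ → R) : ℕ → ℕ → ℕ → R
  | 0, _, _ => 0
  | n + 1, 0, k => if k = n then 1 else 0
  | n + 1, m + 1, 0 => u n * monomialRem u (n + 1) m 0 - u n * monomialRem u n (m + 1) 0
  | n + 1, m + 1, k + 1 => u n * monomialRem u (n + 1) m (k + 1) + monomialRem u n (m + 1) k
      - u n * monomialRem u n (m + 1) (k + 1)
  termination_by n m => (n, m)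

lemma monomialRem_eq_zero {R : Type*} [CommRing R] (u : ℕ → R) (n m k : ℕ) (hk : n ≤ k) :
    monomialRem u n m k = 0 := by
  induction n generalizing m k with
  | zero => simp [monomialRem]
  | succ n ihn =>
    induction m with
    | zero => simp [monomialRem]; omega
    | succ m ihm =>
      obtain ⟨k, rfl⟩ : ∃ l, k = l + 1 := ⟨k - 1, by omega⟩
      simp [monomialRem, ihm, ihn (m + 1) k (by omega), ihn (m + 1) (k + 1) (by omega)]

lemma sum_monomialRem_succ {R : Type*} [CommRing R] (u : ℕ → R) (n m : ℕ) (x : R) :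
    ∑ k ∈ Finset.range (n + 1), monomialRem u (n + 1) (m + 1) k * x ^ k =
      u n * ∑ k ∈ Finset.range (n + 1), monomialRem u (n + 1) m k * x ^ k +
        (x - u n) * ∑ k ∈ Finset.range n, monomialRem u n (m + 1) k * x ^ k := by
  have h : ∑ k ∈ Finset.range n, monomialRem u n (m + 1) k * x ^ k =
      ∑ k ∈ Finset.range (n + 1), monomialRem u n (m + 1) k * x ^ k := by
    rw [Finset.sum_range_succ, monomialRem_eq_zero u n (m + 1) n le_rfl]; ring
  rw [sub_mul]
  nth_rw 2 [h]
  rw [Finset.sum_range_succ', Finset.sum_range_succ' (fun k => monomialRem u (n + 1) m k * x ^ k),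
    Finset.sum_range_succ' (fun k => monomialRem u n (m + 1) k * x ^ k)]
  simp only [monomialRem, add_mul, sub_mul, Finset.sum_add_distrib, Finset.sum_sub_distrib, mul_add,
    Finset.mul_sum, pow_zero, pow_succ]
  simp only [mul_comm, mul_left_comm, mul_assoc]
  ring

lemma sum_monomialRem_mul_pow {R : Type*} [CommRing R] (u : ℕ → R) (n m i : ℕ) (hi : i ≤ n) :
    ∑ k ∈ Finset.range (n + 1), monomialRem u (n + 1) m k * u i ^ k = u i ^ (n + m) := by
  induction n generalizing m i with
  | zero =>
    obtain rfl : i = 0 := by omega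
    induction m with
    | zero => simp [monomialRem]
    | succ m ihm =>
      rw [sum_monomialRem_succ, ihm, Finset.range_zero, Finset.sum_empty]
      ring
  | succ n ihn =>
    induction m with
    | zero =>
      simp [monomialRem]
    | succ m ihm =>
      rw [sum_monomialRem_succ, ihm]
      rcases hi.lt_or_eq with h | rfl
      · rw [ihn (m + 1) i (by omega)]; ring
      · ring

/-- The number of monomials of the hook Schur polynomial equal, up to sign, to
`monomialRem u n m k`. -/
def hookCount (n m k : ℕ) : ℕ :=
  if k < n then (n + m - 1).choose k * (n + m - 1 - k - 1).choose (n - k - 1) else 0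

lemma hookCount_succ_zero (n k : ℕ) : hookCount (n + 1) 0 k = if k = n then 1 else 0 := by
  unfold hookCount
  split_ifs with h1 h2 h2
  · subst h2; simp
  · have : (n + 1 + 0 - 1 - k - 1).choose (n + 1 - k - 1) = 0 :=
      Nat.choose_eq_zero_of_lt (by omega)
    rw [this, mul_zero]
  · omega
  · rfl

lemma hookCount_succ_succ_zero (n m : ℕ) :
    hookCount (n + 1) (m + 1) 0 = hookCount (n + 1) m 0 + hookCount n (m + 1) 0 := by
  unfold hookCount
  rcases n with _ | n
  · simp
  · have h1 : n + 1 + 1 + (m + 1) - 1 - 0 - 1 = (n + m) + 1 := by omega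
    have h2 : n + 1 + 1 + m - 1 - 0 - 1 = n + m := by omega
    have h3 : n + 1 + (m + 1) - 1 - 0 - 1 = n + m := by omega
    simp only [h1, h2, h3]
    simp [Nat.choose_succ_succ]
    ring

lemma hookCount_succ_succ_succ (n m k : ℕ) :
    hookCount (n + 1) (m + 1) (k + 1) =
      hookCount (n + 1) m (k + 1) + hookCount n (m + 1) k + hookCount n (m + 1) (k + 1) := by
  unfold hookCount
  by_cases h : k < n
  · obtain ⟨l, rfl⟩ : ∃ l, n = k + l + 1 := ⟨n - k - 1, by omega⟩
    by_cases h' : l = 0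
    · subst h'
      simp
      rw [show k + 1 + 1 + m = (k + 1 + m) + 1 by omega, Nat.choose_succ_succ]
      exact add_comm _ _
    · obtain ⟨l, rfl⟩ : ∃ j, l = j + 1 := ⟨l - 1, by omega⟩
      rw [if_pos (by omega), if_pos (by omega), if_pos (by omega), if_pos (by omega)]
      have e1 : k + (l + 1) + 1 + 1 + (m + 1) - 1 = (k + l + m + 2) + 1 := by omega
      have e2 : k + (l + 1) + 1 + 1 + m - 1 = k + l + m + 2 := by omega
      have e3 : k + (l + 1) + 1 + (m + 1) - 1 = k + l + m + 2 := by omega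
      have e4 : k + l + m + 2 + 1 - (k + 1) - 1 = (l + m) + 1 := by omega
      have e5 : k + l + m + 2 - (k + 1) - 1 = (l + m) := by omega
      have e6 : k + l + m + 2 - k - 1 = (l + m) + 1 := by omega
      have e7 : k + (l + 1) + 1 + 1 - (k + 1) - 1 = l + 1 := by omega
      have e8 : k + (l + 1) + 1 - k - 1 = l + 1 := by omega
      have e9 : k + (l + 1) + 1 - (k + 1) - 1 = l := by omega
      rw [e1, e2, e3, e4, e5, e6, e7, e8, e9, Nat.choose_succ_succ (k + l + m + 2) k,
        Nat.choose_succ_succ (l + m) l]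
      simp only [Nat.succ_eq_add_one]
      ring
  · rw [if_neg (by omega), if_neg (by omega), if_neg (by omega), if_neg (by omega)]

lemma norm_monomialRem_mul_pow_le (u : ℕ → ℂ) (s : ℝ) (hs : 0 ≤ s) (hu : ∀ i, ‖u i‖ ≤ s)
    (n m k : ℕ) : ‖monomialRem u n m k‖ * s ^ (k + 1) ≤ hookCount n m k * s ^ (n + m) := by
  induction n generalizing m k with
  | zero => simp [monomialRem, hookCount]
  | succ n ihn =>
    induction m generalizing k with
    | zero =>
      rw [hookCount_succ_zero]
      by_cases h : k = n <;> simp [monomialRem, h]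
    | succ m ihm =>
      have key : ∀ a b c : ℂ, ∀ i, ‖u i * a + b - u i * c‖ ≤ s * ‖a‖ + ‖b‖ + s * ‖c‖ := by
        intro a b c i
        calc ‖u i * a + b - u i * c‖ ≤ ‖u i * a‖ + ‖b‖ + ‖u i * c‖ :=
              (norm_sub_le _ _).trans (by gcongr; exact norm_add_le _ _)
          _ ≤ _ := by rw [norm_mul, norm_mul]; gcongr <;> exact hu i
      rcases k with _ | k
      · rw [hookCount_succ_succ_zero]
        have h1 := key (monomialRem u (n + 1) m 0) 0 (monomialRem u n (m + 1) 0) n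
        rw [add_zero, norm_zero, add_zero] at h1
        have h2 := mul_le_mul_of_nonneg_right h1 hs
        have h3 := mul_le_mul_of_nonneg_left (ihm 0) hs
        have h4 := mul_le_mul_of_nonneg_left (ihn (m + 1) 0) hs
        rw [monomialRem]
        push_cast
        ring_nf at h2 h3 h4 ⊢
        linarith
      · rw [hookCount_succ_succ_succ]
        have h1 := key (monomialRem u (n + 1) m (k + 1)) (monomialRem u n (m + 1) k)
          (monomialRem u n (m + 1) (k + 1)) n
        have h2 := mul_le_mul_of_nonneg_right h1 (pow_nonneg hs (k + 1 + 1))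
        have h3 := mul_le_mul_of_nonneg_left (ihm (k + 1)) hs
        have h4 := mul_le_mul_of_nonneg_left (ihn (m + 1) (k + 1)) hs
        have h5 := mul_le_mul_of_nonneg_left (ihn (m + 1) k) hs
        rw [monomialRem]
        push_cast
        ring_nf at h2 h3 h4 h5 ⊢
        linarith

lemma monomialRem_const_mul_pow (s : ℝ) (n m k : ℕ) :
    monomialRem (fun _ => s) n m k * s ^ (k + 1) =
      (-1) ^ (n + k + 1) * hookCount n m k * s ^ (n + m) := by
  induction n generalizing m k with
  | zero => simp [monomialRem, hookCount]
  | succ n ihn =>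
    induction m generalizing k with
    | zero =>
      rw [hookCount_succ_zero]
      by_cases h : k = n
      · have : (-1 : ℝ) ^ (n + 1 + n + 1) = 1 := Even.neg_one_pow ⟨n + 1, by ring⟩
        simp [monomialRem, h, this]
      · simp [monomialRem, h]
    | succ m ihm =>
      rcases k with _ | k
      · rw [hookCount_succ_succ_zero]
        have h3 := congrArg (s * ·) (ihm 0)
        have h4 := congrArg (s * ·) (ihn (m + 1) 0)
        rw [monomialRem]
        push_cast
        ring_nf at h3 h4 ⊢
        linarith
      · rw [hookCount_succ_succ_succ]
        have h3 := congrArg (s * ·) (ihm (k + 1))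
        have h4 := congrArg (s * ·) (ihn (m + 1) (k + 1))
        have h5 := congrArg (s * ·) (ihn (m + 1) k)
        rw [monomialRem]
        push_cast
        ring_nf at h3 h4 h5 ⊢
        linarith

lemma monomialRem_zero_eq_zero (n m k : ℕ) : monomialRem (fun _ => (0 : ℝ)) n (m + 1) k = 0 := by
  induction n generalizing k with
  | zero => simp [monomialRem]
  | succ n ih => cases k <;> simp [monomialRem, ih]

lemma continuous_monomialRem (u : ℝ → ℕ → ℝ) (hu : ∀ i, Continuous fun t => u t i) (n m k : ℕ) :
    Continuous fun t => monomialRem (u t) n m k := by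
  induction n generalizing m k with
  | zero => simpa [monomialRem] using continuous_const
  | succ n ihn =>
    induction m generalizing k with
    | zero => simpa [monomialRem] using continuous_const
    | succ m ihm =>
      have := hu n
      rcases k with _ | k
      · simp only [monomialRem]
        have h1 := ihm 0
        have h2 := ihn (m + 1) 0
        fun_prop
      · simp only [monomialRem]
        have h1 := ihm (k + 1)
        have h2 := ihn (m + 1) (k + 1)
        have h3 := ihn (m + 1) k
        fun_prop

/-- The polynomial function `z ↦ ∑ k < N, c k * z ^ k + c' * z ^ M`. -/
def lacunary {N : ℕ} (c : Fin N → ℝ) (c' : ℝ) (M : ℕ) (z : ℂ) : ℂ :=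
  (∑ k : Fin N, (c k : ℂ) * z ^ (k : ℕ)) + (c' : ℂ) * z ^ M

lemma posSemidef_iff_re {n : ℕ} (H : Matrix (Fin n) (Fin n) ℂ) :
    H.PosSemidef ↔ H.IsHermitian ∧ ∀ w : Fin n → ℂ, 0 ≤ (∑ i, ∑ j, star (w i) * H i j * w j).re := by
  have hsum (w : Fin n → ℂ) :
      star w ⬝ᵥ H.mulVec w = ∑ i, ∑ j, star (w i) * H i j * w j := by
    simp [dotProduct, Matrix.mulVec, Finset.mul_sum, mul_assoc]
  rw [Matrix.posSemidef_iff_dotProduct_mulVec]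
  refine and_congr_right fun hH => forall_congr' fun w => ?_
  rw [hsum, Complex.nonneg_iff, and_iff_left]
  rw [eq_comm, ← Complex.conj_eq_iff_im, map_sum]
  simp_rw [map_sum]
  rw [Finset.sum_comm]
  refine Finset.sum_congr rfl fun i _ => Finset.sum_congr rfl fun j _ => ?_
  have := hH.apply i j
  simp only [RCLike.star_def] at this
  simp only [map_mul, this, RCLike.star_def, Complex.conj_conj]
  ring

lemma isHermitian_lacunary {n N : ℕ} (c : Fin N → ℝ) (c' : ℝ) (M : ℕ)
    {A : Matrix (Fin n) (Fin n) ℂ} (hA : A.IsHermitian) :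
    (Matrix.of fun i j => lacunary c c' M (A i j)).IsHermitian := by
  ext i j
  have := hA.apply i j
  simp only [RCLike.star_def] at this
  simp [lacunary, this]

lemma quadForm_lacunary_rankOne {n N : ℕ} (c : Fin N → ℝ) (c' : ℝ) (M : ℕ) (u w : Fin n → ℂ) :
    (∑ i, ∑ j, star (w i) * lacunary c c' M (u i * star (u j)) * w j).re =
      (∑ k : Fin N, c k * ‖∑ i, star (w i) * u i ^ (k : ℕ)‖ ^ 2) +
        c' * ‖∑ i, star (w i) * u i ^ M‖ ^ 2 := by
  have hpow (k : ℕ) : ∑ i, ∑ j, star (w i) * (u i * star (u j)) ^ k * w j =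
      ((‖∑ i, star (w i) * u i ^ k‖ ^ 2 : ℝ) : ℂ) := by
    rw [Complex.ofReal_pow, ← Complex.mul_conj', map_sum, Finset.sum_mul_sum]
    refine Finset.sum_congr rfl fun i _ => Finset.sum_congr rfl fun j _ => ?_
    simp only [RCLike.star_def, map_mul, map_pow, Complex.conj_conj]
    ring
  have : ∑ i, ∑ j, star (w i) * lacunary c c' M (u i * star (u j)) * w j =
      (∑ k : Fin N, (c k : ℂ) * ∑ i, ∑ j, star (w i) * (u i * star (u j)) ^ (k : ℕ) * w j) +
        (c' : ℂ) * ∑ i, ∑ j, star (w i) * (u i * star (u j)) ^ M * w j := by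
    simp only [lacunary, Finset.mul_sum, mul_add, add_mul, Finset.sum_add_distrib, Finset.sum_mul]
    congr 1
    · simp_rw [Finset.sum_comm (s := Finset.univ (α := Fin N))]
      refine Finset.sum_congr rfl fun i _ => Finset.sum_congr rfl fun j _ =>
        Finset.sum_congr rfl fun k _ => ?_
      ring
    · refine Finset.sum_congr rfl fun i _ => Finset.sum_congr rfl fun j _ => ?_
      ring
  rw [this]
  simp_rw [hpow]
  rw [← Complex.ofReal_re ((∑ k : Fin N, _) + _)]
  push_cast
  rfl

lemma CC_eq_sum_hookCount (n m : ℕ) (c : Fin (n + 1) → ℝ) (ρ : ℝ) :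
    CC (n + 1) c (n + 1 + m) ρ =
      ∑ k : Fin (n + 1), (hookCount (n + 1) (m + 1) k : ℝ) ^ 2 * ρ ^ (n + 1 + m - k) / c k := by
  refine Finset.sum_congr rfl fun k _ => ?_
  rw [hookCount, if_pos k.2]
  push_cast
  rw [mul_pow, show n + 1 + (m + 1) - 1 = n + 1 + m by omega]

lemma sum_mul_pow_eq_sum_monomialRem {R : Type*} [CommRing R] (n m : ℕ) (u v : Fin (n + 1) → R)
    (U : ℕ → R) (hU : ∀ i : Fin (n + 1), U i = u i) :
    ∑ i, v i * u i ^ (n + 1 + m) =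
      ∑ k : Fin (n + 1), monomialRem U (n + 1) (m + 1) k * ∑ i, v i * u i ^ (k : ℕ) := by
  simp_rw [Finset.mul_sum]
  rw [Finset.sum_comm]
  refine Finset.sum_congr rfl fun i _ => ?_
  have h := sum_monomialRem_mul_pow U n (m + 1) i (by omega)
  rw [hU, ← Fin.sum_univ_eq_sum_range (fun k => monomialRem U (n + 1) (m + 1) k * u i ^ k)] at h
  rw [show n + 1 + m = n + (m + 1) by omega, ← h, Finset.mul_sum]
  refine Finset.sum_congr rfl fun k _ => ?_
  ring

lemma norm_monomialRem_sq_le (u : ℕ → ℂ) (ρ : ℝ) (hρ : 0 < ρ) (hu : ∀ i, ‖u i‖ ^ 2 ≤ ρ)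
    (n m k : ℕ) (hk : k ≤ n + m) :
    ‖monomialRem u n (m + 1) k‖ ^ 2 ≤ (hookCount n (m + 1) k : ℝ) ^ 2 * ρ ^ (n + m - k) := by
  have hs := Real.sqrt_pos.2 hρ
  have h := norm_monomialRem_mul_pow_le u (√ρ) hs.le (fun i => Real.le_sqrt_of_sq_le (hu i))
    n (m + 1) k
  rw [show n + (m + 1) = (n + m - k) + (k + 1) by omega, pow_add _ (n + m - k),
    ← mul_assoc] at h
  have h' := le_of_mul_le_mul_right h (by positivity)
  calc _ ≤ ((hookCount n (m + 1) k : ℝ) * √ρ ^ (n + m - k)) ^ 2 := by gcongr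
    _ = _ := by rw [mul_pow, ← pow_mul, mul_comm _ 2, pow_mul, Real.sq_sqrt hρ.le]

lemma posSemidef_lacunary_rankOne (ρ : ℝ) (hρ : 0 < ρ) (n m : ℕ) (c : Fin (n + 1) → ℝ)
    (hc : ∀ k, 0 < c k) (d : ℝ) (hd : 0 ≤ d) (hdC : d * CC (n + 1) c (n + 1 + m) ρ ≤ 1)
    (u : Fin (n + 1) → ℂ) (hu : ∀ i, ‖u i‖ ^ 2 ≤ ρ) :
    (Matrix.of fun i j => lacunary c (-d) (n + 1 + m) (u i * star (u j))).PosSemidef := by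
  rw [posSemidef_iff_re]
  refine ⟨isHermitian_lacunary c (-d) (n + 1 + m) (A := Matrix.of fun i j => u i * star (u j))
    (by ext i j; simp [mul_comm]), fun w => ?_⟩
  simp only [Matrix.of_apply]
  rw [quadForm_lacunary_rankOne]
  set p : ℕ → ℂ := fun k => ∑ i, star (w i) * u i ^ k with hp
  set S := ∑ k : Fin (n + 1), c k * ‖p k‖ ^ 2 with hS
  have hS0 : 0 ≤ S := Finset.sum_nonneg fun k _ => by have := (hc k).le; positivity
  set U : ℕ → ℂ := fun i => if h : i < n + 1 then u ⟨i, h⟩ else 0 with hU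
  have hUn (i : ℕ) : ‖U i‖ ^ 2 ≤ ρ := by
    by_cases h : i < n + 1
    · simpa only [hU, dif_pos h] using hu _
    · simp only [hU, dif_neg h]
      simpa using hρ.le
  have hpM : p (n + 1 + m) = ∑ k : Fin (n + 1), monomialRem U (n + 1) (m + 1) k * p k :=
    sum_mul_pow_eq_sum_monomialRem n m u (fun i => star (w i)) U (fun i => dif_pos i.2)
  have hb : ‖p (n + 1 + m)‖ ^ 2 ≤ CC (n + 1) c (n + 1 + m) ρ * S := by
    rw [CC_eq_sum_hookCount]
    calc ‖p (n + 1 + m)‖ ^ 2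
        ≤ (∑ k : Fin (n + 1), ‖monomialRem U (n + 1) (m + 1) k‖ * ‖p k‖) ^ 2 := by
          rw [hpM]
          gcongr
          refine (norm_sum_le _ _).trans_eq ?_
          simp
      _ ≤ (∑ k : Fin (n + 1), ‖monomialRem U (n + 1) (m + 1) k‖ ^ 2 / c k) * S := by
          refine Finset.sum_sq_le_sum_mul_sum_of_sq_le_mul _ (fun k _ => ?_) (fun k _ => ?_)
            fun k _ => ?_
          · have := (hc k).le; positivity
          · have := (hc k).le; positivity
          · have := (hc k).ne'
            exact le_of_eq (by field_simp)
      _ ≤ _ := by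
          gcongr with k
          · exact (hc k).le
          · exact norm_monomialRem_sq_le U ρ hρ hUn (n + 1) m k (by omega)
  have h1 := mul_le_mul_of_nonneg_left hb hd
  have h2 := mul_le_mul_of_nonneg_right hdC hS0
  show 0 ≤ S + -d * ‖p (n + 1 + m)‖ ^ 2
  linarith

lemma norm_sq_le_diag_mul_diag {n : ℕ} {A : Matrix (Fin n) (Fin n) ℂ} (hA : A.PosSemidef)
    (i j : Fin n) : ‖A i j‖ ^ 2 ≤ ‖A i i‖ * ‖A j j‖ := by
  have h := (hA.submatrix ![i, j]).det_nonneg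
  have hij : A j i = star (A i j) := (hA.isHermitian.apply j i).symm
  have hi := Complex.eq_coe_norm_of_nonneg (hA.diag_nonneg (i := i))
  have hj := Complex.eq_coe_norm_of_nonneg (hA.diag_nonneg (i := j))
  rw [Matrix.det_fin_two] at h
  simp only [Matrix.submatrix_apply, Matrix.cons_val_zero, Matrix.cons_val_one, hij,
    RCLike.star_def, Complex.mul_conj'] at h
  rw [hi, hj] at h
  have h' : (0 : ℝ) ≤ ‖A i i‖ * ‖A j j‖ - ‖A i j‖ ^ 2 := by exact_mod_cast h
  linarith

lemma norm_apply_le_of_diag_le {n : ℕ} {A : Matrix (Fin n) (Fin n) ℂ} (hA : A.PosSemidef)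
    {ρ : ℝ} (hρ : 0 ≤ ρ) (h : ∀ i, ‖A i i‖ ≤ ρ) (i j : Fin n) : ‖A i j‖ ≤ ρ := by
  refine abs_le_of_sq_le_sq' ?_ hρ |>.2
  calc ‖A i j‖ ^ 2 ≤ ‖A i i‖ * ‖A j j‖ := norm_sq_le_diag_mul_diag hA i j
    _ ≤ ρ * ρ := by gcongr <;> apply h
    _ = ρ ^ 2 := by ring

/-- Splitting off from a positive semidefinite matrix a rank-one part with the same zeroth row. -/
lemma exists_rankOne_sub_posSemidef {n : ℕ} {A : Matrix (Fin (n + 1)) (Fin (n + 1)) ℂ}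
    (hA : A.PosSemidef) :
    ∃ u : Fin (n + 1) → ℂ, (∀ i, ‖u i‖ ^ 2 ≤ ‖A i i‖) ∧ (∀ j, A 0 j = u 0 * star (u j)) ∧
      (A - Matrix.of fun i j => u i * star (u j)).PosSemidef := by
  set a := ‖A 0 0‖ with ha
  have h00 : A 0 0 = (a : ℂ) := Complex.eq_coe_norm_of_nonneg hA.diag_nonneg
  have hstar (i j) : star (A i j) = A j i := hA.isHermitian.apply j i
  rcases (norm_nonneg (A 0 0)).eq_or_lt with h0 | h0
  · rw [← ha] at h0
    refine ⟨0, by simp, fun j => ?_, ?_⟩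
    · have := norm_sq_le_diag_mul_diag hA 0 j
      rw [← ha, ← h0, zero_mul] at this
      simpa using this
    · convert hA
      ext i j
      simp
  · rw [← ha] at h0
    have hs : ((√a : ℝ) : ℂ) ≠ 0 := by exact_mod_cast (Real.sqrt_pos.2 h0).ne'
    have hss : ((√a : ℝ) : ℂ) * (√a : ℝ) = a := by exact_mod_cast Real.mul_self_sqrt h0.le
    have hac : (a : ℂ) ≠ 0 := by exact_mod_cast h0.ne'
    have hu (i j) : A i 0 / (√a : ℝ) * star (A j 0 / (√a : ℝ)) = A i 0 * A 0 j / a := by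
      rw [star_div₀, hstar, RCLike.star_def, Complex.conj_ofReal, div_mul_div_comm, hss]
    refine ⟨fun i => A i 0 / (√a : ℝ), fun i => ?_, fun j => ?_, ?_⟩
    · rw [norm_div, div_pow, Complex.norm_real, Real.norm_eq_abs, sq_abs, Real.sq_sqrt h0.le,
        div_le_iff₀ h0]
      exact norm_sq_le_diag_mul_diag hA i 0
    · rw [hu, h00]
      field_simp
    · set P : Matrix (Fin (n + 1)) (Fin (n + 1)) ℂ :=
        1 - Matrix.of fun i j => if i = 0 then A 0 j / a else 0 with hP
      have hAP (i j) : (A * P) i j = A i j - A i 0 * A 0 j / a := by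
        rw [hP, mul_sub, mul_one, Matrix.sub_apply, Matrix.mul_apply]
        simp [mul_div_assoc]
      convert hA.conjTranspose_mul_mul_same P using 1
      ext i j
      rw [mul_assoc, Matrix.sub_apply, Matrix.of_apply, hu, Matrix.mul_apply]
      have hPc (k) : P.conjTranspose i k = (if i = k then 1 else 0) -
          if k = 0 then A i 0 / a else 0 := by
        simp only [hP, Matrix.conjTranspose_apply, Matrix.sub_apply, Matrix.of_apply,
          Matrix.one_apply, star_sub]
        congr 1
        · simp [eq_comm, apply_ite]
        · split_ifs
          · rw [star_div₀, hstar, RCLike.star_def, Complex.conj_ofReal]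
          · simp
      simp only [hPc, hAP, sub_mul, Finset.sum_sub_distrib, ite_mul, one_mul, zero_mul,
        Finset.sum_ite_eq, Finset.sum_ite_eq', Finset.mem_univ, if_true]
      rw [h00]
      field_simp
      ring

lemma posSemidef_of_zero_row {n : ℕ} {H : Matrix (Fin (n + 1)) (Fin (n + 1)) ℂ}
    (hH : (H.submatrix Fin.succ Fin.succ).PosSemidef) (hr : ∀ j, H 0 j = 0)
    (hc : ∀ i, H i 0 = 0) : H.PosSemidef := by
  rw [posSemidef_iff_re] at hH ⊢
  refine ⟨?_, fun w => ?_⟩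
  · ext i j
    rw [Matrix.conjTranspose_apply]
    refine Fin.cases ?_ (fun i => ?_) i
    · simp [hr, hc]
    · refine Fin.cases ?_ (fun j => ?_) j
      · simp [hr, hc]
      · exact hH.1.apply i j
  · have := hH.2 (fun i => w i.succ)
    simpa [Fin.sum_univ_succ, hr, hc] using this

lemma hasDerivAt_lacunary_segment {n M : ℕ} (c : Fin (n + 1) → ℝ) (c' : ℝ) (b e : ℂ) (t : ℝ) :
    HasDerivAt (fun t : ℝ => lacunary c c' (M + 1) (b + t * e))
      (e * lacunary (fun k : Fin n => ((k : ℕ) + 1) * c k.succ) ((M + 1) * c') M (b + t * e)) t := by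
  have hz : HasDerivAt (fun t : ℝ => b + t * e) e t := by
    simpa using ((Complex.ofRealCLM.hasDerivAt (x := t)).mul_const e).const_add b
  have hpow (k : ℕ) := hz.pow k
  have h := (HasDerivAt.fun_sum (u := Finset.univ)
    fun (k : Fin (n + 1)) _ => (hpow k).const_mul (c k : ℂ)).add ((hpow (M + 1)).const_mul (c' : ℂ))
  refine h.congr_deriv ?_
  rw [Fin.sum_univ_succ]
  simp only [lacunary, mul_add, Finset.mul_sum]
  simp
  congr 1
  · refine Finset.sum_congr rfl fun k _ => ?_
    ring
  · ring

/-- Entrywise functions preserve the Loewner order along a segment whose entrywise derivatives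
preserve it. -/
lemma posSemidef_lacunary_of_segment {n M : ℕ} (N : ℕ) (c : Fin (n + 1) → ℝ) (c' : ℝ)
    {A B : Matrix (Fin N) (Fin N) ℂ} (hA : A.IsHermitian)
    (hB : (Matrix.of fun i j => lacunary c c' (M + 1) (B i j)).PosSemidef)
    (hd : ∀ t ∈ Set.Icc (0 : ℝ) 1, (Matrix.of fun i j => (A i j - B i j) *
      lacunary (fun k : Fin n => ((k : ℕ) + 1) * c k.succ) ((M + 1) * c') M
        (B i j + t * (A i j - B i j))).PosSemidef) :
    (Matrix.of fun i j => lacunary c c' (M + 1) (A i j)).PosSemidef := by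
  rw [posSemidef_iff_re] at hB ⊢
  refine ⟨isHermitian_lacunary c c' (M + 1) hA, fun w => (hB.2 w).trans ?_⟩
  set φ : ℝ → ℝ := fun t => (∑ i, ∑ j, star (w i) *
    lacunary c c' (M + 1) (B i j + t * (A i j - B i j)) * w j).re with hφ
  have hder (t : ℝ) : HasDerivAt φ (∑ i, ∑ j, star (w i) * ((A i j - B i j) *
      lacunary (fun k : Fin n => ((k : ℕ) + 1) * c k.succ) ((M + 1) * c') M
        (B i j + t * (A i j - B i j))) * w j).re t := by
    have h := HasDerivAt.fun_sum (u := Finset.univ) fun (i : Fin N) _ =>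
      HasDerivAt.fun_sum (u := Finset.univ) fun (j : Fin N) _ =>
        ((hasDerivAt_lacunary_segment (M := M) c c' (B i j) (A i j - B i j) t).const_mul
          (star (w i))).mul_const (w j)
    exact Complex.reCLM.hasFDerivAt.comp_hasDerivAt t h
  have hmono : MonotoneOn φ (Set.Icc 0 1) := by
    refine monotoneOn_of_deriv_nonneg (convex_Icc 0 1)
      (fun t _ => (hder t).continuousAt.continuousWithinAt)
      (fun t _ => (hder t).differentiableAt.differentiableWithinAt) fun t ht => ?_
    rw [(hder t).deriv]
    exact ((posSemidef_iff_re _).1 (hd t (interior_subset ht))).2 w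
  have h01 := hmono (Set.left_mem_Icc.2 zero_le_one) (Set.right_mem_Icc.2 zero_le_one) zero_le_one
  simpa [hφ] using h01

lemma CC_nonneg {N M : ℕ} {c : Fin N → ℝ} (hc : ∀ k, 0 < c k) {ρ : ℝ} (hρ : 0 < ρ) :
    0 ≤ CC N c M ρ :=
  Finset.sum_nonneg fun k _ => by have := (hc k).le; positivity

lemma mul_CC_derivative_le (n M : ℕ) (c : Fin (n + 1) → ℝ) (hc : ∀ k, 0 < c k) (ρ : ℝ)
    (hρ : 0 < ρ) :
    (M + 1) * CC n (fun k : Fin n => ((k : ℕ) + 1) * c k.succ) M ρ ≤ CC (n + 1) c (M + 1) ρ := by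
  rw [CC, CC, Fin.sum_univ_succ, Finset.mul_sum]
  refine le_add_of_nonneg_of_le ?_ (Finset.sum_le_sum fun k _ => ?_)
  · have := (hc 0).le
    positivity
  · have hck := hc k.succ
    have hch : ((M : ℝ) + 1) * M.choose k = (M + 1).choose (k + 1) * (k + 1) := by
      exact_mod_cast Nat.add_one_mul_choose_eq M k
    have hle : (M.choose k : ℝ) ≤ (M + 1).choose (k + 1) := by
      exact_mod_cast Nat.choose_succ_succ M k ▸ Nat.le_add_right _ _
    have e1 : M + 1 - (k.succ : ℕ) = M - k := by simp
    have e2 : n + 1 - (k.succ : ℕ) = n - k := by simp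
    rw [e1, e2, Fin.val_succ, mul_div_assoc', div_le_div_iff₀ (by positivity) hck]
    have key : ((M : ℝ) + 1) * (M.choose k : ℝ) ^ 2 ≤
        ((M + 1).choose (k + 1) : ℝ) ^ 2 * (k + 1) := by
      rw [sq, ← mul_assoc, hch, sq]
      nlinarith [mul_le_mul_of_nonneg_left hle
        (show (0 : ℝ) ≤ (M + 1).choose (k + 1) * (k + 1) by positivity)]
    have := mul_le_mul_of_nonneg_right key
      (show 0 ≤ ((M - k - 1).choose (n - k - 1) : ℝ) ^ 2 * ρ ^ (M - k) * c k.succ by positivity)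
    linarith

theorem posSemidef_lacunary (ρ : ℝ) (hρ : 0 < ρ) (n m : ℕ) (c : Fin n → ℝ)
    (hc : ∀ k, 0 < c k) (d : ℝ) (hd : 0 ≤ d) (hdC : d * CC n c (n + m) ρ ≤ 1)
    (A : Matrix (Fin n) (Fin n) ℂ) (hA : A.PosSemidef) (hAρ : ∀ i, ‖A i i‖ ≤ ρ) :
    (Matrix.of fun i j => lacunary c (-d) (n + m) (A i j)).PosSemidef := by
  induction n generalizing d with
  | zero =>
    rw [Subsingleton.elim (Matrix.of _) (0 : Matrix (Fin 0) (Fin 0) ℂ)]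
    exact Matrix.PosSemidef.zero
  | succ n ih =>
    obtain ⟨u, hu, hu0, hAu⟩ := exists_rankOne_sub_posSemidef hA
    have hr1 := posSemidef_lacunary_rankOne ρ hρ n m c hc d hd hdC u
      (fun i => (hu i).trans (hAρ i))
    have hBpsd : (Matrix.of fun i j => u i * star (u j)).PosSemidef :=
      Matrix.posSemidef_vecMulVec_self_star u
    have hu0' (i) : A i 0 = u i * star (u 0) := by
      rw [← hA.isHermitian.apply, hu0]
      simp [mul_comm]
    rw [show n + 1 + m = n + m + 1 by omega] at hr1 hdC ⊢
    refine posSemidef_lacunary_of_segment (n + 1) c (-d)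
      (B := Matrix.of fun i j => u i * star (u j)) hA.isHermitian hr1 fun t ht => ?_
    refine posSemidef_of_zero_row ?_ (fun j => ?_) fun i => ?_
    · have hC : (Matrix.of (fun i j => u i * star (u j)) +
          t • (A - Matrix.of fun i j => u i * star (u j))).PosSemidef :=
        hBpsd.add (hAu.smul ht.1)
      have hcast : (((n + m : ℕ) : ℝ) + 1) * -d = -((((n + m : ℕ) : ℝ) + 1) * d) := by ring
      have hI := ih (fun k : Fin n => ((k : ℕ) + 1) * c k.succ)
        (fun k => mul_pos (by positivity) (hc _)) ((((n + m : ℕ) : ℝ) + 1) * d) (by positivity)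
        (by
          have := mul_le_mul_of_nonneg_left (mul_CC_derivative_le n (n + m) c hc ρ hρ) hd
          linarith)
        _ (hC.submatrix Fin.succ) (fun i => ?_)
      · have hprod : (((A - Matrix.of fun i j => u i * star (u j)).submatrix Fin.succ
            Fin.succ).hadamard _).PosSemidef := (hAu.submatrix Fin.succ).hadamard hI
        convert hprod using 1
        ext i j
        simp only [Matrix.submatrix_apply, Matrix.of_apply, Matrix.hadamard_apply,
          Matrix.sub_apply, Matrix.add_apply, Matrix.smul_apply, Complex.real_smul, hcast]
      · simp only [Matrix.submatrix_apply, Matrix.of_apply, Matrix.sub_apply, Matrix.add_apply,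
          Matrix.smul_apply, Complex.real_smul]
        have h1 : ‖u i.succ * star (u i.succ)‖ ≤ ρ := by
          rw [norm_mul, norm_star, ← sq]
          exact (hu _).trans (hAρ _)
        calc _ = ‖((1 - t : ℝ) : ℂ) * (u i.succ * star (u i.succ)) + (t : ℂ) * A i.succ i.succ‖ := by
              congr 1; push_cast; ring
          _ ≤ (1 - t) * ρ + t * ρ := by
              refine (norm_add_le _ _).trans ?_
              have h0 := ht.1
              have h2 := sub_nonneg.2 ht.2
              rw [norm_mul (t : ℂ), norm_mul ((1 - t : ℝ) : ℂ), Complex.norm_of_nonneg h0,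
                Complex.norm_of_nonneg h2]
              gcongr
              exact hAρ _
          _ = ρ := by ring
    · simp [hu0]
    · simp [hu0']

lemma posSemidef_hadPow {n : ℕ} {A : Matrix (Fin n) (Fin n) ℂ} (hA : A.PosSemidef) (k : ℕ) :
    (hadPow A k).PosSemidef := by
  induction k with
  | zero =>
    convert Matrix.posSemidef_vecMulVec_self_star (fun _ : Fin n => (1 : ℂ))
    ext i j
    simp [hadPow, Matrix.vecMulVec_apply]
  | succ k ih =>
    have hprod : ((hadPow A k).hadamard A).PosSemidef := ih.hadamard hA
    convert hprod using 1
    ext i j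
    simp [hadPow, pow_succ]

lemma posSemidef_lacunary_of_nonneg {n N : ℕ} (c : Fin N → ℝ) (hc : ∀ k, 0 ≤ c k) (c' : ℝ)
    (hc' : 0 ≤ c') (M : ℕ) {A : Matrix (Fin n) (Fin n) ℂ} (hA : A.PosSemidef) :
    (Matrix.of fun i j => lacunary c c' M (A i j)).PosSemidef := by
  have h := (Matrix.posSemidef_sum Finset.univ fun (k : Fin N) _ =>
    (posSemidef_hadPow hA k).smul (hc k)).add ((posSemidef_hadPow hA M).smul hc')
  convert h
  ext i j
  simp [lacunary, hadPow, Matrix.sum_apply]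

lemma exists_sum_mul_pow_eq {n : ℕ} {u : Fin n → ℝ} (hu : Function.Injective u) (y : Fin n → ℝ) :
    ∃ w : Fin n → ℝ, ∀ k : Fin n, ∑ i, w i * u i ^ (k : ℕ) = y k := by
  have hV : IsUnit (Matrix.vandermonde u).det :=
    isUnit_iff_ne_zero.2 (Matrix.det_vandermonde_ne_zero_iff.2 hu)
  refine ⟨Matrix.vecMul y (Matrix.vandermonde u)⁻¹, fun k => ?_⟩
  have h : Matrix.vecMul (Matrix.vecMul y (Matrix.vandermonde u)⁻¹) (Matrix.vandermonde u) = y := by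
    rw [Matrix.vecMul_vecMul, Matrix.nonsing_inv_mul _ hV, Matrix.vecMul_one]
  exact congrFun h k

/-- `f[A]` is positive semidefinite for all rank-one `A` with entries in `(0, ρ)`. -/
def PreservesRankOne (N : ℕ) (ρ : ℝ) (f : ℂ → ℂ) : Prop :=
  ∀ A : Matrix (Fin N) (Fin N) ℂ, A.PosSemidef → A.rank ≤ 1 →
    (∀ i j, ∃ x : ℝ, x ∈ Set.Ioo (0 : ℝ) ρ ∧ A i j = (x : ℂ)) →
    (Matrix.of fun i j => f (A i j)).PosSemidef

lemma PreservesRankOne.quadForm_nonneg {n m : ℕ} {ρ : ℝ} (hρ : 0 < ρ) {c : Fin (n + 1) → ℝ}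
    {c' : ℝ} (h : PreservesRankOne (n + 1) ρ (lacunary c c' (n + 1 + m))) (U : ℕ → ℝ)
    (hinj : Function.Injective U) (hU : ∀ i ≤ n, U i ∈ Set.Ioo 0 (√ρ)) (y : Fin (n + 1) → ℝ) :
    0 ≤ (∑ k, c k * y k ^ 2) +
      c' * (∑ k : Fin (n + 1), monomialRem U (n + 1) (m + 1) k * y k) ^ 2 := by
  set u : Fin (n + 1) → ℝ := fun i => U i with hu
  obtain ⟨w, hw⟩ := exists_sum_mul_pow_eq (u := u) (fun i j hij => Fin.ext (hinj hij)) y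
  have hpsd := h (Matrix.vecMulVec (fun i => (u i : ℂ)) (star fun i => (u i : ℂ)))
    (Matrix.posSemidef_vecMulVec_self_star _) (Matrix.rank_vecMulVec_le _ _) fun i j => by
      have hi := hU i (by omega)
      have hj := hU j (by omega)
      refine ⟨u i * u j, ⟨mul_pos hi.1 hj.1, ?_⟩, by simp [Matrix.vecMulVec_apply]⟩
      calc u i * u j < √ρ * √ρ := mul_lt_mul'' hi.2 hj.2 hi.1.le hj.1.le
        _ = ρ := Real.mul_self_sqrt hρ.le
  have hq := ((posSemidef_iff_re _).1 hpsd).2 fun i => (w i : ℂ)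
  simp only [Matrix.of_apply, Matrix.vecMulVec_apply, Pi.star_apply] at hq
  rw [quadForm_lacunary_rankOne] at hq
  have hnorm (k : ℕ) : ‖∑ i, star (w i : ℂ) * (u i : ℂ) ^ k‖ ^ 2 = (∑ i, w i * u i ^ k) ^ 2 := by
    rw [← sq_abs (∑ i, w i * u i ^ k), ← Real.norm_eq_abs, ← Complex.norm_real]
    simp
  simp_rw [hnorm, hw] at hq
  rw [sum_mul_pow_eq_sum_monomialRem n m u w U fun _ => rfl] at hq
  simpa only [hw] using hq

lemma PreservesRankOne.quadForm_nonneg_limit {n m : ℕ} {ρ : ℝ} (hρ : 0 < ρ) {c : Fin (n + 1) → ℝ}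
    {c' : ℝ} (h : PreservesRankOne (n + 1) ρ (lacunary c c' (n + 1 + m))) (U : ℝ → ℕ → ℝ)
    (hcont : ∀ i, Continuous fun t => U t i)
    (hinj : ∀ t ∈ Set.Ioo (0 : ℝ) 1, Function.Injective (U t))
    (hU : ∀ t ∈ Set.Ioo (0 : ℝ) 1, ∀ i ≤ n, U t i ∈ Set.Ioo 0 (√ρ)) (y : Fin (n + 1) → ℝ) :
    0 ≤ (∑ k, c k * y k ^ 2) +
      c' * (∑ k : Fin (n + 1), monomialRem (U 0) (n + 1) (m + 1) k * y k) ^ 2 := by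
  have hF : Continuous fun t => (∑ k, c k * y k ^ 2) +
      c' * (∑ k : Fin (n + 1), monomialRem (U t) (n + 1) (m + 1) k * y k) ^ 2 := by
    have := fun k : ℕ => continuous_monomialRem U hcont (n + 1) (m + 1) k
    fun_prop
  refine ge_of_tendsto ((hF.tendsto 0).mono_left (nhdsWithin_le_nhds (s := Set.Ioi 0))) ?_
  filter_upwards [Ioo_mem_nhdsGT one_pos] with t ht
  exact h.quadForm_nonneg hρ (U t) (hinj t ht) (hU t ht) y

lemma PreservesRankOne.coeff_nonneg {n m : ℕ} {ρ : ℝ} (hρ : 0 < ρ) {c : Fin (n + 1) → ℝ}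
    {c' : ℝ} (h : PreservesRankOne (n + 1) ρ (lacunary c c' (n + 1 + m))) (k : Fin (n + 1)) :
    0 ≤ c k := by
  have hs := Real.sqrt_pos.2 hρ
  have hq := h.quadForm_nonneg_limit hρ (fun t i => t * (√ρ * ((i + 1) / (n + 1))))
    (fun i => by fun_prop)
    (fun t ht i j hij => by
      have := ht.1.ne'
      have := hs.ne'
      have hn : (n : ℝ) + 1 ≠ 0 := by positivity
      field_simp at hij
      exact_mod_cast add_right_cancel hij)
    (fun t ht i hi => by
      have := ht.1
      refine ⟨by positivity, ?_⟩
      have h1 : ((i : ℝ) + 1) / (n + 1) ≤ 1 := by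
        rw [div_le_one (by positivity)]
        exact_mod_cast Nat.succ_le_succ hi
      calc t * (√ρ * ((i + 1) / (n + 1))) ≤ t * (√ρ * 1) := by gcongr
        _ < √ρ := by nlinarith [ht.2])
    (Pi.single k 1)
  simp only [zero_mul, monomialRem_zero_eq_zero] at hq
  simpa [Pi.single_apply] using hq

lemma monomialRem_const_sq (s : ℝ) (hs : 0 < s) (n m k : ℕ) (hk : k ≤ n + m) :
    monomialRem (fun _ => s) n (m + 1) k ^ 2 =
      (hookCount n (m + 1) k : ℝ) ^ 2 * (s ^ 2) ^ (n + m - k) := by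
  have h := monomialRem_const_mul_pow s n (m + 1) k
  rw [show n + (m + 1) = (n + m - k) + (k + 1) by omega, pow_add _ (n + m - k), ← mul_assoc] at h
  rw [mul_right_cancel₀ (by positivity) h, mul_pow, mul_pow, ← pow_mul, mul_comm _ 2, pow_mul]
  simp [← pow_mul, mul_comm]

lemma hookCount_pos {n m k : ℕ} (hk : k < n) : 0 < hookCount n (m + 1) k := by
  rw [hookCount, if_pos hk]
  exact Nat.mul_pos (Nat.choose_pos (by omega)) (Nat.choose_pos (by omega))

lemma PreservesRankOne.coeff_pos_and_le {n m : ℕ} {ρ : ℝ} (hρ : 0 < ρ) {c : Fin (n + 1) → ℝ}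
    {c' : ℝ} (h : PreservesRankOne (n + 1) ρ (lacunary c c' (n + 1 + m))) (hc' : c' < 0) :
    (∀ k, 0 < c k) ∧ -(CC (n + 1) c (n + 1 + m) ρ)⁻¹ ≤ c' := by
  have hs := Real.sqrt_pos.2 hρ
  have hq := h.quadForm_nonneg_limit hρ (fun t i => √ρ * (1 - t / (i + 1)))
    (fun i => by fun_prop)
    (fun t ht i j hij => by
      have h1 := sub_right_injective (mul_left_cancel₀ hs.ne' hij)
      have h2 := ht.1.ne'
      have hi : (i : ℝ) + 1 ≠ 0 := by positivity
      have hj : (j : ℝ) + 1 ≠ 0 := by positivity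
      field_simp at h1
      exact_mod_cast (add_right_cancel h1).symm)
    (fun t ht i hi => by
      have h0 := ht.1
      have h1 : 0 < t / ((i : ℝ) + 1) := by positivity
      have h2 : t / ((i : ℝ) + 1) < 1 := by
        rw [div_lt_one (by positivity)]
        have : (0 : ℝ) ≤ i := by positivity
        linarith [ht.2]
      exact ⟨mul_pos hs (by linarith), by nlinarith⟩)
  simp only [zero_div, sub_zero, mul_one] at hq
  set r : Fin (n + 1) → ℝ := fun k => monomialRem (fun _ => √ρ) (n + 1) (m + 1) k with hr
  have hr2 (k) : r k ^ 2 =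
      (hookCount (n + 1) (m + 1) k : ℝ) ^ 2 * ρ ^ (n + 1 + m - (k : ℕ)) := by
    rw [hr, monomialRem_const_sq (√ρ) hs (n + 1) m k (by omega), Real.sq_sqrt hρ.le]
  have hrpos (k) : 0 < r k ^ 2 := by
    have : (0 : ℝ) < hookCount (n + 1) (m + 1) k := by exact_mod_cast hookCount_pos k.2
    rw [hr2]
    positivity
  have hc (k) : 0 < c k := by
    have h1 := hq (Pi.single k 1)
    have h2 : 0 ≤ c k + c' * r k ^ 2 := by simpa [Pi.single_apply] using h1
    nlinarith [hrpos k]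
  have hCC : CC (n + 1) c (n + 1 + m) ρ = ∑ k, r k ^ 2 / c k := by
    rw [CC_eq_sum_hookCount]
    simp_rw [hr2]
  have hCpos : 0 < CC (n + 1) c (n + 1 + m) ρ := by
    rw [hCC]
    exact Finset.sum_pos (fun k _ => div_pos (hrpos k) (hc k)) Finset.univ_nonempty
  refine ⟨hc, ?_⟩
  have h1 := hq fun k => r k / c k
  have h2 : ∑ k, c k * (r k / c k) ^ 2 = CC (n + 1) c (n + 1 + m) ρ := by
    rw [hCC]
    refine Finset.sum_congr rfl fun k _ => ?_
    have := (hc k).ne'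
    field_simp
  have h3 : ∑ k, r k * (r k / c k) = CC (n + 1) c (n + 1 + m) ρ := by
    rw [hCC]
    refine Finset.sum_congr rfl fun k _ => ?_
    ring
  rw [h2, h3] at h1
  rw [neg_le, ← one_div, le_div_iff₀ hCpos]
  nlinarith

theorem stmt_0 (ρ : ℝ) (hρ : 0 < ρ) (N M : ℕ) (hN : 1 ≤ N) (hM : N ≤ M)
    (c : Fin N → ℝ) (c' : ℝ) :
    ((∀ A : Matrix (Fin N) (Fin N) ℂ, A.PosSemidef →
        (∀ i j, A i j ∈ Metric.closedBall (0 : ℂ) ρ) →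
        (Matrix.of fun i j =>
          (∑ k : Fin N, (c k : ℂ) * A i j ^ (k : ℕ)) + (c' : ℂ) * A i j ^ M).PosSemidef)
      ↔ ((∀ j, 0 ≤ c j) ∧ 0 ≤ c') ∨ ((∀ j, 0 < c j) ∧ -(CC N c M ρ)⁻¹ ≤ c'))
    ∧
    ((∀ A : Matrix (Fin N) (Fin N) ℂ, A.PosSemidef →
        (∀ i j, A i j ∈ Metric.closedBall (0 : ℂ) ρ) →
        (Matrix.of fun i j =>
          (∑ k : Fin N, (c k : ℂ) * A i j ^ (k : ℕ)) + (c' : ℂ) * A i j ^ M).PosSemidef)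
      ↔ (∀ A : Matrix (Fin N) (Fin N) ℂ, A.PosSemidef → A.rank ≤ 1 →
        (∀ i j, ∃ x : ℝ, x ∈ Set.Ioo (0 : ℝ) ρ ∧ A i j = (x : ℂ)) →
        (Matrix.of fun i j =>
          (∑ k : Fin N, (c k : ℂ) * A i j ^ (k : ℕ)) + (c' : ℂ) * A i j ^ M).PosSemidef)) := by
  obtain ⟨n, rfl⟩ : ∃ n, N = n + 1 := ⟨N - 1, by omega⟩
  obtain ⟨m, rfl⟩ : ∃ m, M = n + 1 + m := ⟨M - (n + 1), by omega⟩
  have h12 (h : ((∀ j, 0 ≤ c j) ∧ 0 ≤ c') ∨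
      ((∀ j, 0 < c j) ∧ -(CC (n + 1) c (n + 1 + m) ρ)⁻¹ ≤ c'))
      (A : Matrix (Fin (n + 1)) (Fin (n + 1)) ℂ) (hA : A.PosSemidef)
      (hAρ : ∀ i j, A i j ∈ Metric.closedBall (0 : ℂ) ρ) :
      (Matrix.of fun i j => lacunary c c' (n + 1 + m) (A i j)).PosSemidef := by
    rcases le_or_gt 0 c' with hc' | hc'
    · exact posSemidef_lacunary_of_nonneg c
        (fun j => h.elim (fun h => h.1 j) fun h => (h.1 j).le) c' hc' _ hA
    · obtain ⟨hc, hle⟩ := h.resolve_left fun h => hc'.not_ge h.2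
      have hd : -c' * CC (n + 1) c (n + 1 + m) ρ ≤ 1 := by
        calc -c' * CC (n + 1) c (n + 1 + m) ρ
            ≤ (CC (n + 1) c (n + 1 + m) ρ)⁻¹ * CC (n + 1) c (n + 1 + m) ρ :=
              mul_le_mul_of_nonneg_right (by linarith) (CC_nonneg hc hρ)
          _ ≤ 1 := inv_mul_le_one
      have := posSemidef_lacunary ρ hρ (n + 1) m c hc (-c') (by linarith) hd A hA
        fun i => by simpa using hAρ i i
      rwa [neg_neg] at this
  have h23 (h : PreservesRankOne (n + 1) ρ (lacunary c c' (n + 1 + m))) :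
      ((∀ j, 0 ≤ c j) ∧ 0 ≤ c') ∨
        ((∀ j, 0 < c j) ∧ -(CC (n + 1) c (n + 1 + m) ρ)⁻¹ ≤ c') := by
    rcases le_or_gt 0 c' with hc' | hc'
    · exact .inl ⟨h.coeff_nonneg hρ, hc'⟩
    · exact .inr (h.coeff_pos_and_le hρ hc')
  have h13 (h : ∀ A : Matrix (Fin (n + 1)) (Fin (n + 1)) ℂ, A.PosSemidef →
      (∀ i j, A i j ∈ Metric.closedBall (0 : ℂ) ρ) →
      (Matrix.of fun i j => lacunary c c' (n + 1 + m) (A i j)).PosSemidef) :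
      PreservesRankOne (n + 1) ρ (lacunary c c' (n + 1 + m)) := fun A hA _ hAρ =>
    h A hA fun i j => by
      obtain ⟨x, hx, hxA⟩ := hAρ i j
      simpa [hxA, abs_of_pos hx.1] using hx.2.le
  exact ⟨⟨fun h => h23 (h13 h), h12⟩, ⟨h13, fun h => h12 (h23 h)⟩⟩
end
end

section
/- Fix ρ > 0, integers M ≥ N ≥ 1, and positive reals c_0, …, c_{N−1}. Then for every A ∈ 𝒫_N(D̄(0,ρ)), one has A^{∘M} ≤ 𝒞(c; z^M; N, ρ) · (c_0·1_{N×N} + c_1 A + ⋯ + c_{N−1} A^{∘(N−1)}) in the Loewner order (i.e., the difference is positive semidefinite). Moreover the constant 𝒞(c; z^M; N, ρ) is sharp: no smaller constant satisfies this inequality for all A ∈ 𝒫_N(D̄(0,ρ)). -/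
open scoped ComplexOrder

noncomputable section

/-- Up to the sign `(-1) ^ (N - 1 - j)`, the coefficient of `z ^ j` in the remainder of
`z ^ (N - 1 + m)` modulo `∏ i < N, (z - u i)`; it is a hook Schur polynomial in the `u i`. -/
def hookSchur {R : Type*} [CommSemiring R] (u : ℕ → R) : ℕ → ℕ → ℕ → R
  | 0, _, _ => 0
  | N + 1, 0, j => if j = N then 1 else 0
  | N + 1, m + 1, 0 => u N * hookSchur u (N + 1) m 0 + u N * hookSchur u N (m + 1) 0
  | N + 1, m + 1, j + 1 => u N * hookSchur u (N + 1) m (j + 1) + hookSchur u N (m + 1) j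
      + u N * hookSchur u N (m + 1) (j + 1)

theorem hookSchur_eq_zero {R : Type*} [CommSemiring R] (u : ℕ → R) (N m j : ℕ) (h : N ≤ j) :
    hookSchur u N m j = 0 := by
  fun_induction hookSchur u N m j with
  | case1 => rfl
  | case2 N => omega
  | case3 => rfl
  | case4 => omega
  | case5 N m j ih1 ih2 ih3 => rw [ih1 h, ih2 (by omega), ih3 (by omega)]; simp

theorem norm_hookSchur_le (u : ℕ → ℂ) (r : ℝ) (hu : ∀ i, ‖u i‖ ≤ r) (N m j : ℕ) :
    ‖hookSchur u N m j‖ ≤ hookSchur (fun _ => r) N m j := by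
  have hr : 0 ≤ r := (norm_nonneg _).trans (hu 0)
  fun_induction hookSchur u N m j with
  | case1 => simp [hookSchur]
  | case2 => simp [hookSchur]
  | case3 N m h => simp [hookSchur, h]
  | case4 N m ih1 ih2 =>
    rw [hookSchur]
    refine (norm_add_le _ _).trans ?_
    rw [norm_mul, norm_mul]
    gcongr <;> exact hu N
  | case5 N m j ih1 ih2 ih3 =>
    rw [hookSchur]
    refine (norm_add₃_le).trans ?_
    rw [norm_mul, norm_mul]
    gcongr <;> exact hu N

theorem hookSchur_const {R : Type*} [CommSemiring R] (r : R) (N m j : ℕ) (h : j < N)  :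
    hookSchur (fun _ => r) N m j =
      ((N - 1 + m).choose j * (N - 1 + m - j - 1).choose (N - j - 1) : ℕ) * r ^ (N - 1 + m - j) := by
  induction N generalizing m j with
  | zero => omega
  | succ N ihN =>
    induction m generalizing j with
    | zero =>
      rw [hookSchur]
      split_ifs with hj
      · subst hj; simp
      · rw [show (N + 1 - 1 + 0 - j - 1).choose (N + 1 - j - 1) = 0 from
          Nat.choose_eq_zero_of_lt (by omega)]
        simp
    | succ m ihm =>
      cases j with
      | zero =>
        rw [hookSchur, ihm 0 (by omega)]
        rcases N with _ | N
        · simp [hookSchur, pow_succ']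
        · rw [ihN _ 0 (by omega)]
          simp only [Nat.choose_zero_right, one_mul, Nat.sub_zero, Nat.add_sub_cancel]
          rw [show N + 1 + (m + 1) - 1 = (N + m) + 1 by omega,
            show N + (m + 1) - 1 = N + m by omega, show N + 1 + m - 1 = N + m by omega,
            Nat.choose_succ_succ]
          push_cast
          ring
      | succ j =>
        rw [hookSchur, ihm (j + 1) h, ihN _ j (by omega)]
        rcases Nat.lt_or_ge (j + 1) N with h1 | h1
        · rw [ihN _ (j + 1) h1]
          obtain ⟨d, rfl⟩ : ∃ d, N = j + 2 + d := ⟨N - (j + 2), by omega⟩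
          rw [show j + 2 + d + 1 - 1 + (m + 1) = (j + 2 + d + m) + 1 by omega,
            show j + 2 + d + 1 - 1 + m = j + 2 + d + m by omega,
            show j + 2 + d - 1 + (m + 1) = j + 2 + d + m by omega,
            show j + 2 + d + m + 1 - (j + 1) = (d + m + 1) + 1 by omega,
            show j + 2 + d + m - (j + 1) = d + m + 1 by omega,
            show j + 2 + d + m - j = d + m + 1 + 1 by omega,
            show j + 2 + d + 1 - (j + 1) - 1 = d + 1 by omega,
            show j + 2 + d - j - 1 = d + 1 by omega,
            show j + 2 + d - (j + 1) - 1 = d by omega]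
          simp only [Nat.add_sub_cancel]
          rw [Nat.choose_succ_succ (j + 2 + d + m) j, Nat.choose_succ_succ (d + m) d]
          push_cast
          ring
        · obtain rfl : N = j + 1 := by omega
          rw [hookSchur_eq_zero _ _ _ _ le_rfl]
          simp only [Nat.add_sub_cancel, show j + 1 + 1 - (j + 1) - 1 = 0 by omega,
            show j + 1 - j - 1 = 0 by omega, Nat.choose_zero_right, mul_one]
          rw [show j + 1 + (m + 1) = (j + 1 + m) + 1 by omega,
            show j + (m + 1) = j + 1 + m by omega, Nat.choose_succ_succ (j + 1 + m) j,
            show j + 1 + m + 1 - (j + 1) = m + 1 by omega,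
            show j + 1 + m - (j + 1) = m by omega,
            show j + 1 + m - j = m + 1 by omega]
          push_cast
          ring

theorem continuous_hookSchur (N m j : ℕ) :
    Continuous fun u : ℕ → ℝ => hookSchur u N m j := by
  induction N generalizing m j with
  | zero => simp only [hookSchur]; fun_prop
  | succ N ihN =>
    induction m generalizing j with
    | zero => simp only [hookSchur]; fun_prop
    | succ m ihm =>
      cases j with
      | zero =>
        simp only [hookSchur]
        have := ihm 0
        have := ihN (m + 1) 0
        fun_prop
      | succ j =>
        simp only [hookSchur]
        have := ihm (j + 1)
        have := ihN (m + 1) j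
        have := ihN (m + 1) (j + 1)
        fun_prop

theorem sum_hookSchur_succ_succ {R : Type*} [CommRing R] (u : ℕ → R) (N m : ℕ) (x : R) :
    ∑ j ∈ Finset.range (N + 1), (-1) ^ (N - j) * hookSchur u (N + 1) (m + 1) j * x ^ j =
      u N * ∑ j ∈ Finset.range (N + 1), (-1) ^ (N - j) * hookSchur u (N + 1) m j * x ^ j +
      (x - u N) *
        ∑ j ∈ Finset.range N, (-1) ^ (N - 1 - j) * hookSchur u N (m + 1) j * x ^ j := by
  have h : ∑ j ∈ Finset.range N, (-1) ^ (N - 1 - j) * hookSchur u N (m + 1) j * x ^ j =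
      -∑ j ∈ Finset.range (N + 1), (-1) ^ (N - j) * hookSchur u N (m + 1) j * x ^ j := by
    rw [Finset.sum_range_succ, hookSchur_eq_zero u N (m + 1) N le_rfl, mul_zero, zero_mul,
      add_zero, ← Finset.sum_neg_distrib]
    refine Finset.sum_congr rfl fun j hj => ?_
    rw [Finset.mem_range] at hj
    rw [show N - j = N - 1 - j + 1 by omega, pow_succ]
    ring
  rw [sub_mul]
  nth_rw 2 [h]
  rw [Finset.sum_range_succ', Finset.sum_range_succ' _ N, Finset.sum_range_succ' _ N]
  have h' : ∑ j ∈ Finset.range N,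
        (-1) ^ (N - (j + 1)) * hookSchur u (N + 1) (m + 1) (j + 1) * x ^ (j + 1) =
      u N * ∑ j ∈ Finset.range N,
        (-1) ^ (N - (j + 1)) * hookSchur u (N + 1) m (j + 1) * x ^ (j + 1) +
      x * ∑ j ∈ Finset.range N, (-1) ^ (N - 1 - j) * hookSchur u N (m + 1) j * x ^ j +
      u N * ∑ j ∈ Finset.range N,
        (-1) ^ (N - (j + 1)) * hookSchur u N (m + 1) (j + 1) * x ^ (j + 1) := by
    simp only [Finset.mul_sum, ← Finset.sum_add_distrib]
    refine Finset.sum_congr rfl fun j _ => ?_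
    rw [hookSchur, show N - (j + 1) = N - 1 - j by omega]
    ring
  rw [h', hookSchur]
  ring

theorem pow_eq_sum_hookSchur {R : Type*} [CommRing R] (u : ℕ → R) (N m i : ℕ) (hi : i < N) :
    u i ^ (N - 1 + m) =
      ∑ j ∈ Finset.range N, (-1) ^ (N - 1 - j) * hookSchur u N m j * u i ^ j := by
  induction N generalizing m with
  | zero => omega
  | succ N ihN =>
    simp only [Nat.add_sub_cancel]
    induction m with
    | zero => simp [hookSchur]
    | succ m ihm =>
      rw [sum_hookSchur_succ_succ, ← ihm]
      rcases Nat.lt_or_ge i N with h | h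
      · rw [← ihN _ h, show N - 1 + (m + 1) = N + m by omega]
        ring
      · obtain rfl : i = N := by omega
        ring

open scoped Matrix

theorem hadPow_posSemidef {N : ℕ} {A : Matrix (Fin N) (Fin N) ℂ} (hA : A.PosSemidef) (k : ℕ) :
    (hadPow A k).PosSemidef := by
  induction k with
  | zero =>
    convert Matrix.posSemidef_vecMulVec_self_star (1 : Fin N → ℂ) using 1
    ext i j
    simp [hadPow, Matrix.vecMulVec_apply]
  | succ k ih =>
    have h : hadPow A (k + 1) = hadPow A k ⊙ A := by
      ext i j
      simp [hadPow, pow_succ]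
    rw [h]
    exact ih.hadamard hA

theorem hadPow_isHermitian {N : ℕ} {A : Matrix (Fin N) (Fin N) ℂ} (hA : A.IsHermitian) (k : ℕ) :
    (hadPow A k).IsHermitian := by
  ext i j
  simp [hadPow, ← hA.apply j i]

theorem hadPow_combination_isHermitian {N : ℕ} {A : Matrix (Fin N) (Fin N) ℂ}
    (hA : A.IsHermitian) (C : ℝ) (c : Fin N → ℝ) (M : ℕ) :
    ((C : ℂ) • ∑ j : Fin N, (c j : ℂ) • hadPow A (j : ℕ) - hadPow A M).IsHermitian := by
  have h : ∀ r : ℝ, IsSelfAdjoint (r : ℂ) := fun r => Complex.conj_ofReal r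
  refine Matrix.IsHermitian.sub (IsSelfAdjoint.smul (h C) ?_) (hadPow_isHermitian hA M)
  exact isSelfAdjoint_sum _ fun j _ => IsSelfAdjoint.smul (h _) (hadPow_isHermitian hA j)

theorem hadPow_vecMulVec {N : ℕ} (u : Fin N → ℂ) (k : ℕ) :
    hadPow (Matrix.vecMulVec u (star u)) k = Matrix.vecMulVec (u ^ k) (star (u ^ k)) := by
  ext i j
  simp [hadPow, Matrix.vecMulVec_apply, mul_pow]

theorem dotProduct_vecMulVec_star_mulVec {N : ℕ} (u x : Fin N → ℂ) :
    star x ⬝ᵥ (Matrix.vecMulVec u (star u) *ᵥ x) = ((‖star u ⬝ᵥ x‖ ^ 2 : ℝ) : ℂ) := by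
  rw [Matrix.vecMulVec_mulVec, Complex.ofReal_pow, ← Complex.conj_mul']
  simp only [dotProduct_smul, MulOpposite.smul_eq_mul_unop, MulOpposite.unop_op]
  congr 1
  exact Matrix.star_dotProduct x u

theorem dotProduct_rankOne_combination_mulVec {N : ℕ} (u x : Fin N → ℂ) (C : ℝ) (c : Fin N → ℝ)
    (M : ℕ) :
    star x ⬝ᵥ (((C : ℂ) • ∑ j : Fin N, (c j : ℂ) • hadPow (Matrix.vecMulVec u (star u)) (j : ℕ)
      - hadPow (Matrix.vecMulVec u (star u)) M) *ᵥ x) =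
    ((C * ∑ j : Fin N, c j * ‖star (u ^ (j : ℕ)) ⬝ᵥ x‖ ^ 2 - ‖star (u ^ M) ⬝ᵥ x‖ ^ 2 : ℝ) : ℂ) := by
  simp only [hadPow_vecMulVec, Matrix.sub_mulVec, Matrix.smul_mulVec, Matrix.sum_mulVec,
    dotProduct_sub, dotProduct_smul, dotProduct_sum, dotProduct_vecMulVec_star_mulVec, smul_eq_mul]
  push_cast
  rfl

theorem CC_eq_sum_hookSchur {ρ : ℝ} (hρ : 0 ≤ ρ) (N m : ℕ) (c : Fin (N + 1) → ℝ) :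
    CC (N + 1) c (N + m) ρ =
      ∑ j : Fin (N + 1), hookSchur (fun _ => √ρ) (N + 1) m j ^ 2 / c j := by
  refine Finset.sum_congr rfl fun j _ => ?_
  rw [hookSchur_const _ _ _ _ j.2, mul_pow, ← pow_mul, mul_comm _ 2, pow_mul, Real.sq_sqrt hρ]
  push_cast
  simp only [mul_pow]

theorem rankOne_posSemidef {ρ : ℝ} (hρ : 0 ≤ ρ) (N m : ℕ) (c : Fin (N + 1) → ℝ)
    (hc : ∀ j, 0 < c j) (u : Fin (N + 1) → ℂ) (hu : ∀ i, ‖u i‖ ≤ √ρ) :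
    ((CC (N + 1) c (N + m) ρ : ℂ) •
      ∑ j : Fin (N + 1), (c j : ℂ) • hadPow (Matrix.vecMulVec u (star u)) (j : ℕ)
      - hadPow (Matrix.vecMulVec u (star u)) (N + m)).PosSemidef := by
  refine Matrix.PosSemidef.of_dotProduct_mulVec_nonneg
    (hadPow_combination_isHermitian (Matrix.posSemidef_vecMulVec_self_star u).1 _ _ _) fun x => ?_
  rw [dotProduct_rankOne_combination_mulVec, Complex.zero_le_real, sub_nonneg]
  set v : ℕ → ℂ := fun i => if h : i < N + 1 then u ⟨i, h⟩ else 0 with hv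
  have hvr : ∀ i, ‖v i‖ ≤ √ρ := by
    intro i
    simp only [hv]
    split_ifs with h
    · exact hu _
    · simp
  have huv : ∀ i : Fin (N + 1), u i = v i := fun i => by
    simp only [hv, dif_pos i.2]
  have hpow : u ^ (N + m) = ∑ j : Fin (N + 1),
      ((-1) ^ (N - j) * hookSchur v (N + 1) m j) • u ^ (j : ℕ) := by
    ext i
    have := pow_eq_sum_hookSchur v (N + 1) m i i.2
    simp only [Nat.add_sub_cancel] at this
    simp only [Pi.pow_apply, Finset.sum_apply, Pi.smul_apply, smul_eq_mul, huv, this]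
    rw [Finset.sum_range]
  have hle : ‖star (u ^ (N + m)) ⬝ᵥ x‖ ≤ ∑ j : Fin (N + 1),
      hookSchur (fun _ => √ρ) (N + 1) m j * ‖star (u ^ (j : ℕ)) ⬝ᵥ x‖ := by
    rw [hpow, star_sum, sum_dotProduct]
    refine (norm_sum_le _ _).trans (Finset.sum_le_sum fun j _ => ?_)
    rw [star_smul, smul_dotProduct, norm_smul]
    gcongr
    simpa using norm_hookSchur_le v _ hvr (N + 1) m j
  refine (pow_le_pow_left₀ (norm_nonneg _) hle 2).trans ?_
  rw [CC_eq_sum_hookSchur hρ]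
  refine Finset.sum_sq_le_sum_mul_sum_of_sq_le_mul _ (fun j _ => ?_) (fun j _ => ?_) fun j _ => ?_
  · have := hc j; positivity
  · have := hc j; positivity
  · have := (hc j).ne'
    apply le_of_eq
    field_simp

theorem exists_rankOne_deflation {n : ℕ} {A : Matrix (Fin (n + 1)) (Fin (n + 1)) ℂ}
    (hA : A.PosSemidef) :
    ∃ z : Fin (n + 1) → ℂ, (A - Matrix.vecMulVec z (star z)).PosSemidef ∧
      (∀ i, (A - Matrix.vecMulVec z (star z)) i 0 = 0) ∧
      ∀ i, (A - Matrix.vecMulVec z (star z)) 0 i = 0 := by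
  have h0 := hA.diag_nonneg (i := 0)
  rcases h0.eq_or_lt with h | h
  · have hcol : ∀ i, A i 0 = 0 := by
      have := (hA.dotProduct_mulVec_zero_iff (Pi.single 0 1)).1 (by simp [← h])
      intro i
      simpa using congrFun this i
    refine ⟨0, by simpa using hA, by simpa using hcol, fun i => ?_⟩
    simp [← hA.1.apply 0 i, hcol]
  · obtain ⟨a, ha⟩ : ∃ a : ℝ, A 0 0 = (a : ℂ) := ⟨(A 0 0).re, (Complex.eq_re_of_ofReal_le h0)⟩
    have hapos : 0 < a := by rw [ha] at h; exact_mod_cast h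
    have hsq : ((√a : ℝ) : ℂ) * ((√a : ℝ) : ℂ) = A 0 0 := by
      rw [ha, ← Complex.ofReal_mul, Real.mul_self_sqrt hapos.le]
    have hz : ∀ i j, (A - Matrix.vecMulVec (fun i => A i 0 / ((√a : ℝ) : ℂ))
        (star fun i => A i 0 / ((√a : ℝ) : ℂ))) i j = A i j - A i 0 * A 0 j / A 0 0 := by
      intro i j
      rw [Matrix.sub_apply, Matrix.vecMulVec_apply, ← hA.1.apply 0 j, ← hsq]
      simp [div_mul_div_comm]
    refine ⟨fun i => A i 0 / ((√a : ℝ) : ℂ), ?_, fun i => ?_, fun i => ?_⟩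
    · convert hA.conjTranspose_mul_mul_same
        (1 - Matrix.vecMulVec (Pi.single 0 1) (fun j => A 0 j / A 0 0)) using 1
      ext i j
      rw [hz]
      have hst : ∀ i, star (A 0 i) = A i 0 := fun i => hA.1.apply i 0
      simp [Matrix.conjTranspose_sub, Matrix.conjTranspose_vecMulVec, sub_mul, mul_sub,
        Matrix.vecMulVec_mul, Matrix.mul_vecMulVec, Matrix.vecMulVec_apply, hst]
      field_simp
      ring
    · rw [hz]; field_simp; ring
    · rw [hz]; field_simp; ring

theorem CC_derivative_le {ρ : ℝ} (hρ : 0 ≤ ρ) (n M : ℕ) (c : Fin (n + 1) → ℝ)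
    (hc : ∀ j, 0 < c j) :
    CC n (fun j => ((j : ℝ) + 1) * c j.succ / (M + 1)) M ρ ≤ CC (n + 1) c (M + 1) ρ := by
  rw [CC, CC, Fin.sum_univ_succ]
  refine le_add_of_nonneg_of_le (by have := hc 0; positivity) (Finset.sum_le_sum fun j _ => ?_)
  have hcj := hc j.succ
  have hch : ((M + 1).choose (j + 1) : ℝ) = (M + 1) / (j + 1) * M.choose j := by
    have := Nat.add_one_mul_choose_eq M j
    field_simp
    exact_mod_cast this.symm
  rw [Fin.val_succ, hch, Nat.add_sub_add_right, Nat.add_sub_add_right]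
  rcases Nat.lt_or_ge M j with hlt | hge
  · simp [Nat.choose_eq_zero_of_lt hlt]
  have h1 : (1 : ℝ) ≤ (M + 1) / (j + 1) := by
    rw [one_le_div (by positivity)]
    exact_mod_cast Nat.succ_le_succ hge
  set q : ℝ := (M + 1) / (j + 1) with hq
  have hc' : ((j : ℝ) + 1) * c j.succ / (M + 1) = c j.succ / q := by
    rw [hq]; field_simp
  rw [hc', div_div_eq_mul_div]
  refine div_le_div_of_nonneg_right ?_ hcj.le
  set X : ℝ := (M.choose j : ℝ) ^ 2 * ((M - (j : ℕ) - 1).choose (n - (j : ℕ) - 1) : ℝ) ^ 2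
    * ρ ^ (M - (j : ℕ)) with hX
  have hX0 : 0 ≤ X := by positivity
  calc X * q ≤ X * q ^ 2 := mul_le_mul_of_nonneg_left (le_self_pow₀ h1 two_ne_zero) hX0
    _ = _ := by rw [hX]; ring

theorem hadPow_apply {N : ℕ} (A : Matrix (Fin N) (Fin N) ℂ) (k : ℕ) (i j : Fin N) :
    hadPow A k i j = A i j ^ k := rfl

theorem combination_apply {N : ℕ} (C : ℝ) (c : Fin N → ℝ) (M : ℕ) (A : Matrix (Fin N) (Fin N) ℂ)
    (k l : Fin N) :
    ((C : ℂ) • ∑ j : Fin N, (c j : ℂ) • hadPow A (j : ℕ) - hadPow A M) k l =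
      C * ∑ j : Fin N, c j * A k l ^ (j : ℕ) - A k l ^ M := by
  simp [Matrix.sum_apply, hadPow_apply]

theorem dotProduct_mulVec_eq_submatrix_succ {n : ℕ} (E : Matrix (Fin (n + 1)) (Fin (n + 1)) ℂ)
    (hcol : ∀ i, E i 0 = 0) (hrow : ∀ i, E 0 i = 0) (x : Fin (n + 1) → ℂ) :
    star x ⬝ᵥ (E *ᵥ x) =
      star (x ∘ Fin.succ) ⬝ᵥ (E.submatrix Fin.succ Fin.succ *ᵥ (x ∘ Fin.succ)) := by
  simp [dotProduct, Matrix.mulVec, Fin.sum_univ_succ, hcol, hrow]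

theorem combination_posSemidef {ρ : ℝ} (hρ : 0 ≤ ρ) (N M : ℕ) (hM : N ≤ M) (c : Fin N → ℝ)
    (hc : ∀ j, 0 < c j) (A : Matrix (Fin N) (Fin N) ℂ) (hA : A.PosSemidef)
    (hAρ : ∀ i j, ‖A i j‖ ≤ ρ) (C : ℝ) (hC : CC N c M ρ ≤ C) :
    ((C : ℂ) • ∑ j : Fin N, (c j : ℂ) • hadPow A (j : ℕ) - hadPow A M).PosSemidef := by
  induction N generalizing M C with
  | zero =>
    rw [Subsingleton.elim (_ - _) 0]
    exact Matrix.PosSemidef.zero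
  | succ n ih =>
    obtain ⟨M, rfl⟩ : ∃ M', M = M' + 1 := ⟨M - 1, by omega⟩
    have hmono : ∀ B : Matrix (Fin (n + 1)) (Fin (n + 1)) ℂ, B.PosSemidef →
        ((CC (n + 1) c (M + 1) ρ : ℂ) • ∑ j : Fin (n + 1), (c j : ℂ) • hadPow B (j : ℕ)
          - hadPow B (M + 1)).PosSemidef →
        ((C : ℂ) • ∑ j : Fin (n + 1), (c j : ℂ) • hadPow B (j : ℕ)
          - hadPow B (M + 1)).PosSemidef := by
      intro B hB h
      have hS : (∑ j : Fin (n + 1), (c j : ℂ) • hadPow B (j : ℕ)).PosSemidef :=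
        Matrix.posSemidef_sum _ fun j _ => (hadPow_posSemidef hB j).smul
          (Complex.zero_le_real.2 (hc j).le)
      have hCC : (0 : ℂ) ≤ ((C - CC (n + 1) c (M + 1) ρ : ℝ) : ℂ) :=
        Complex.zero_le_real.2 (sub_nonneg.2 hC)
      convert h.add (hS.smul hCC) using 1
      push_cast
      rw [sub_smul]
      abel
    obtain ⟨z, hB, hcol, hrow⟩ := exists_rankOne_deflation hA
    set Z := Matrix.vecMulVec z (star z) with hZ
    set B := A - Z with hBdef
    have hZpsd : Z.PosSemidef := Matrix.posSemidef_vecMulVec_self_star z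
    have hzρ : ∀ i, ‖z i‖ ≤ √ρ := by
      intro i
      apply Real.le_sqrt_of_sq_le
      have h := hB.diag_nonneg (i := i)
      rw [hBdef, Matrix.sub_apply, sub_nonneg, hZ, Matrix.vecMulVec_apply, Pi.star_apply,
        ← starRingEnd_apply, Complex.mul_conj'] at h
      have h' := (Complex.le_def.1 h).1
      rw [← Complex.ofReal_pow, Complex.ofReal_re] at h'
      exact h'.trans ((Complex.re_le_norm _).trans (hAρ i i))
    have hZρ : ∀ i j, ‖Z i j‖ ≤ ρ := by
      intro i j
      rw [hZ, Matrix.vecMulVec_apply, norm_mul, Pi.star_apply, norm_star]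
      calc _ ≤ √ρ * √ρ := by gcongr <;> exact hzρ _
        _ = ρ := Real.mul_self_sqrt hρ
    have hZ0 : ((C : ℂ) • ∑ j : Fin (n + 1), (c j : ℂ) • hadPow Z (j : ℕ)
          - hadPow Z (M + 1)).PosSemidef := by
      apply hmono Z hZpsd
      have := rankOne_posSemidef hρ n (M + 1 - n) c hc z hzρ
      rwa [show n + (M + 1 - n) = M + 1 by omega] at this
    refine Matrix.PosSemidef.of_dotProduct_mulVec_nonneg
      (hadPow_combination_isHermitian hA.1 _ _ _) fun x => ?_
    set F : Matrix (Fin (n + 1)) (Fin (n + 1)) ℂ → Matrix (Fin (n + 1)) (Fin (n + 1)) ℂ :=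
      fun W => (C : ℂ) • ∑ j : Fin (n + 1), (c j : ℂ) • hadPow W (j : ℕ) - hadPow W (M + 1) with hF
    set W : ℝ → Matrix (Fin (n + 1)) (Fin (n + 1)) ℂ := fun t => Z + (t : ℂ) • B with hW
    set c' : Fin n → ℝ := fun j => ((j : ℝ) + 1) * c j.succ / (M + 1) with hc'
    set D : ℝ → Matrix (Fin n) (Fin n) ℂ := fun t =>
      ((M + 1 : ℝ) : ℂ) • ((C : ℂ) • ∑ j : Fin n, (c' j : ℂ) •
        hadPow ((W t).submatrix Fin.succ Fin.succ) (j : ℕ) -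
        hadPow ((W t).submatrix Fin.succ Fin.succ) M) with hD
    have hDpsd : ∀ t : ℝ, 0 ≤ t → t ≤ 1 → (D t).PosSemidef := by
      intro t h0 h1
      have hWt : W t = ((1 - t : ℝ) : ℂ) • Z + (t : ℂ) • A := by
        simp only [hW, hBdef]
        push_cast
        rw [smul_sub, sub_smul, one_smul]
        abel
      have hWpsd : (W t).PosSemidef :=
        hZpsd.add (hB.smul (Complex.zero_le_real.2 h0))
      refine (ih M (by omega) c' (fun j => ?_) _ (hWpsd.submatrix _) (fun i j => ?_) C
        ((CC_derivative_le hρ n M c hc).trans hC)).smul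
        (Complex.zero_le_real.2 (by positivity))
      · have := hc j.succ
        positivity
      · rw [hWt, Matrix.submatrix_apply, Matrix.add_apply, Matrix.smul_apply, Matrix.smul_apply]
        refine (norm_add_le _ _).trans ?_
        rw [norm_smul, norm_smul, Complex.norm_real, Complex.norm_real, Real.norm_of_nonneg h0,
          Real.norm_of_nonneg (sub_nonneg.2 h1)]
        have h2 := mul_le_mul_of_nonneg_left (hZρ i.succ j.succ) (sub_nonneg.2 h1)
        have h3 := mul_le_mul_of_nonneg_left (hAρ i.succ j.succ) h0
        linarith
    have hentry : ∀ (t : ℝ) (i j : Fin (n + 1)), HasDerivAt (fun s : ℝ => F (W s) i j)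
        (B i j * (C * ∑ k : Fin n, c k.succ * ((k + 1) * W t i j ^ (k : ℕ)) -
          (M + 1) * W t i j ^ M)) t := by
      intro t i j
      have hWd : HasDerivAt (fun s : ℝ => W s i j) (B i j) t := by
        simp only [hW, Matrix.add_apply, Matrix.smul_apply, smul_eq_mul]
        simpa using ((Complex.ofRealCLM.hasDerivAt (x := t)).mul_const (B i j)).const_add (Z i j)
      simp only [hF, combination_apply]
      have h := ((HasDerivAt.fun_sum (u := Finset.univ) fun (k : Fin (n + 1)) _ =>
        (hWd.pow (k : ℕ)).const_mul (c k : ℂ)).const_mul (C : ℂ)).sub (hWd.pow (M + 1))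
      refine h.congr_deriv ?_
      rw [Fin.sum_univ_succ]
      simp only [Fin.val_zero, Fin.val_succ, Nat.add_sub_cancel, Nat.cast_zero, zero_mul, mul_zero,
        zero_add, mul_sub, Finset.mul_sum]
      congr 1
      · refine Finset.sum_congr rfl fun k _ => ?_
        push_cast
        ring
      · push_cast
        ring
    have hderiv : ∀ t : ℝ, HasDerivAt (fun s => (star x ⬝ᵥ (F (W s) *ᵥ x)).re)
        (star (x ∘ Fin.succ) ⬝ᵥ ((B.submatrix Fin.succ Fin.succ ⊙ D t) *ᵥ (x ∘ Fin.succ))).re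
        t := by
      intro t
      set E : Matrix (Fin (n + 1)) (Fin (n + 1)) ℂ := Matrix.of fun i j =>
        B i j * (C * ∑ k : Fin n, c k.succ * ((k + 1) * W t i j ^ (k : ℕ)) -
          (M + 1) * W t i j ^ M) with hE
      have hE' : B.submatrix Fin.succ Fin.succ ⊙ D t = E.submatrix Fin.succ Fin.succ := by
        have hM0 : (M + 1 : ℂ) ≠ 0 := by exact_mod_cast Nat.succ_ne_zero M
        ext i j
        simp only [hE, hD, Matrix.hadamard_apply, Matrix.submatrix_apply, Matrix.smul_apply,
          combination_apply, Matrix.of_apply, smul_eq_mul, hc']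
        congr 1
        push_cast
        rw [mul_sub, mul_left_comm, Finset.mul_sum]
        congr 2
        refine Finset.sum_congr rfl fun k _ => ?_
        field_simp
      rw [hE', ← dotProduct_mulVec_eq_submatrix_succ E (fun i => by simp [hE, hcol])
        (fun i => by simp [hE, hrow])]
      refine Complex.reCLM.hasFDerivAt.comp_hasDerivAt t ?_
      simp only [dotProduct, Matrix.mulVec]
      exact HasDerivAt.fun_sum fun i _ => (HasDerivAt.fun_sum fun j _ =>
        (hentry t i j).mul_const (x j)).const_mul _
    have hmonoOn : MonotoneOn (fun s => (star x ⬝ᵥ (F (W s) *ᵥ x)).re) (Set.Icc 0 1) := by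
      refine monotoneOn_of_hasDerivWithinAt_nonneg (convex_Icc 0 1)
        (fun t _ => (hderiv t).continuousAt.continuousWithinAt)
        (fun t _ => (hderiv t).hasDerivWithinAt) fun t ht => ?_
      have ht' := interior_subset ht
      exact (Complex.le_def.1 (((hB.submatrix Fin.succ).hadamard
        (hDpsd t ht'.1 ht'.2)).dotProduct_mulVec_nonneg (x ∘ Fin.succ))).1
    have h01 := hmonoOn (Set.left_mem_Icc.2 zero_le_one) (Set.right_mem_Icc.2 zero_le_one)
      zero_le_one
    have hW0 : W 0 = Z := by simp [hW]
    have hW1 : W 1 = A := by simp [hW, hBdef]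
    simp only [hW0, hW1] at h01
    have hnn := (Complex.le_def.1 (hZ0.dotProduct_mulVec_nonneg x)).1
    have him : (star x ⬝ᵥ (F A *ᵥ x)).im = 0 :=
      (hadPow_combination_isHermitian hA.1 C c (M + 1)).im_star_dotProduct_mulVec_self x
    exact Complex.le_def.2 ⟨hnn.trans h01, him.symm⟩

theorem exists_dotProduct_pow_eq {N : ℕ} (u w : Fin N → ℝ) (hu : Function.Injective u) :
    ∃ v : Fin N → ℝ, ∀ j : Fin N, (u ^ (j : ℕ)) ⬝ᵥ v = w j := by
  have hdet : IsUnit (Matrix.vandermonde u)ᵀ.det := by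
    rw [Matrix.det_transpose]
    exact (Matrix.det_vandermonde_ne_zero_iff.2 hu).isUnit
  refine ⟨(Matrix.vandermonde u)ᵀ⁻¹ *ᵥ w, fun j => ?_⟩
  have : (Matrix.vandermonde u)ᵀ *ᵥ ((Matrix.vandermonde u)ᵀ⁻¹ *ᵥ w) = w := by
    rw [Matrix.mulVec_mulVec, Matrix.mul_nonsing_inv _ hdet, Matrix.one_mulVec]
  exact congrFun this j

/-- If the inequality with constant `C` holds for the rank-one matrix of distinct real nodes `u i`,
then `C` dominates the corresponding weighted sum of squares of hook Schur polynomials, as long as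
that sum is positive. -/
theorem sq_le_mul_of_rankOne {N m : ℕ} (u : ℕ → ℝ)
    (hu : Function.Injective fun i : Fin (N + 1) => u i) (c : Fin (N + 1) → ℝ)
    (hc : ∀ j, 0 < c j) (C : ℝ)
    (h : ((C : ℂ) • ∑ j : Fin (N + 1), (c j : ℂ) • hadPow (Matrix.vecMulVec
      (fun i : Fin (N + 1) => (u i : ℂ)) (star fun i : Fin (N + 1) => (u i : ℂ))) (j : ℕ)
      - hadPow (Matrix.vecMulVec
      (fun i : Fin (N + 1) => (u i : ℂ)) (star fun i : Fin (N + 1) => (u i : ℂ)))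
        (N + m)).PosSemidef) :
    (∑ j : Fin (N + 1), hookSchur u (N + 1) m j ^ 2 / c j) ^ 2 ≤
      C * ∑ j : Fin (N + 1), hookSchur u (N + 1) m j ^ 2 / c j := by
  obtain ⟨v, hv⟩ := exists_dotProduct_pow_eq _
    (fun j : Fin (N + 1) => (-1) ^ (N - j) * hookSchur u (N + 1) m j / c j) hu
  have hreal : ∀ k : ℕ, star ((fun i : Fin (N + 1) => (u i : ℂ)) ^ k) ⬝ᵥ (fun i => (v i : ℂ)) =
      (((fun i : Fin (N + 1) => u i) ^ k ⬝ᵥ v : ℝ) : ℂ) := by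
    intro k
    simp [dotProduct]
  have hpow : (fun i : Fin (N + 1) => u i) ^ (N + m) ⬝ᵥ v =
      ∑ j : Fin (N + 1), hookSchur u (N + 1) m j ^ 2 / c j := by
    have : (fun i : Fin (N + 1) => u i) ^ (N + m) = ∑ j : Fin (N + 1),
        ((-1) ^ (N - j) * hookSchur u (N + 1) m j) • (fun i : Fin (N + 1) => u i) ^ (j : ℕ) := by
      ext i
      have := pow_eq_sum_hookSchur u (N + 1) m i i.2
      simp only [Nat.add_sub_cancel] at this
      simp only [Pi.pow_apply, Finset.sum_apply, Pi.smul_apply, smul_eq_mul, this]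
      rw [Finset.sum_range]
    rw [this, sum_dotProduct]
    refine Finset.sum_congr rfl fun j _ => ?_
    rw [smul_dotProduct, hv, smul_eq_mul]
    have h1 : ((-1 : ℝ) ^ (N - (j : ℕ))) * (-1) ^ (N - (j : ℕ)) = 1 := by
      rw [← mul_pow]; simp
    calc _ = ((-1 : ℝ) ^ (N - (j : ℕ)) * (-1) ^ (N - (j : ℕ))) *
        (hookSchur u (N + 1) m j ^ 2 / c j) := by ring
      _ = _ := by rw [h1, one_mul]
  have h' := h.dotProduct_mulVec_nonneg fun i => (v i : ℂ)
  rw [dotProduct_rankOne_combination_mulVec, Complex.zero_le_real, sub_nonneg] at h'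
  simp only [hreal, Complex.norm_real, hpow, hv, Real.norm_eq_abs, sq_abs] at h'
  refine h'.trans_eq ?_
  congr 1
  refine Finset.sum_congr rfl fun j _ => ?_
  have := (hc j).ne'
  have h1 : ((-1 : ℝ) ^ (N - (j : ℕ))) ^ 2 = 1 := by rw [← pow_mul, mul_comm, pow_mul]; simp
  rw [div_pow, mul_pow, h1]
  field_simp

theorem CC_pos {ρ : ℝ} (hρ : 0 < ρ) (N M : ℕ) (hM : N + 1 ≤ M) (c : Fin (N + 1) → ℝ)
    (hc : ∀ j, 0 < c j) : 0 < CC (N + 1) c M ρ := by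
  refine Finset.sum_pos (fun j _ => ?_) Finset.univ_nonempty
  have h1 : 0 < M.choose j := Nat.choose_pos (by omega)
  have h2 : 0 < (M - (j : ℕ) - 1).choose (N + 1 - (j : ℕ) - 1) := Nat.choose_pos (by omega)
  have := hc j
  positivity

theorem stmt_3 (ρ : ℝ) (hρ : 0 < ρ) (N M : ℕ) (hN : 1 ≤ N) (hM : N ≤ M)
    (c : Fin N → ℝ) (hc : ∀ j, 0 < c j) :
    (∀ A : Matrix (Fin N) (Fin N) ℂ, A.PosSemidef →
      (∀ i j, A i j ∈ Metric.closedBall (0 : ℂ) ρ) →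
      ((CC N c M ρ : ℂ) • ∑ j : Fin N, (c j : ℂ) • hadPow A (j : ℕ) - hadPow A M).PosSemidef)
    ∧ ∀ C' : ℝ,
      (∀ A : Matrix (Fin N) (Fin N) ℂ, A.PosSemidef →
        (∀ i j, A i j ∈ Metric.closedBall (0 : ℂ) ρ) →
        ((C' : ℂ) • ∑ j : Fin N, (c j : ℂ) • hadPow A (j : ℕ) - hadPow A M).PosSemidef) →
      CC N c M ρ ≤ C' := by
  obtain ⟨N, rfl⟩ : ∃ n, N = n + 1 := ⟨N - 1, by omega⟩
  refine ⟨fun A hA hAρ => combination_posSemidef hρ.le _ _ hM c hc A hA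
    (fun i j => mem_closedBall_zero_iff.1 (hAρ i j)) _ le_rfl, fun C' hC' => ?_⟩
  obtain ⟨m, rfl⟩ : ∃ m, M = N + m := ⟨M - N, by omega⟩
  set u : ℝ → ℕ → ℝ := fun ε i => √ρ / (1 + ε * i) with hu
  set S : ℝ → ℝ := fun ε => ∑ j : Fin (N + 1), hookSchur (u ε) (N + 1) m j ^ 2 / c j with hS
  have hS0 : S 0 = CC (N + 1) c (N + m) ρ := by
    rw [CC_eq_sum_hookSchur hρ.le]
    simp [hS, hu]
  have hucont : ContinuousAt u 0 := by
    refine continuousAt_pi.2 fun i => ?_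
    simp only [hu]
    exact ContinuousAt.div₀ (by fun_prop) (by fun_prop) (by simp)
  have hScont : ContinuousAt S 0 := by
    refine tendsto_finsetSum _ fun j _ => ?_
    exact ((((continuous_hookSchur (N + 1) m j).continuousAt).comp hucont).pow 2).div_const _
  have hlim : Filter.Tendsto S (nhdsWithin 0 (Set.Ioi 0)) (nhds (CC (N + 1) c (N + m) ρ)) := by
    rw [← hS0]
    exact hScont.tendsto.mono_left nhdsWithin_le_nhds
  refine le_of_tendsto hlim ?_
  filter_upwards [hlim.eventually (lt_mem_nhds (CC_pos hρ N (N + m) hM c hc)), self_mem_nhdsWithin]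
    with ε hεS hε
  have hε : 0 < ε := hε
  have hsρ : 0 < √ρ := Real.sqrt_pos.2 hρ
  have hinj : Function.Injective fun i : Fin (N + 1) => u ε i := by
    intro i j hij
    simp only [hu] at hij
    rw [div_eq_div_iff (by positivity) (by positivity)] at hij
    have hij' := mul_left_cancel₀ hε.ne' (add_left_cancel (mul_left_cancel₀ hsρ.ne' hij))
    exact Fin.ext (by exact_mod_cast hij'.symm)
  have hle : ∀ i : ℕ, |u ε i| ≤ √ρ := by
    intro i
    simp only [hu]
    rw [abs_of_nonneg (by positivity)]
    refine div_le_self hsρ.le ?_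
    have : 0 ≤ ε * i := by positivity
    linarith
  have hsq := sq_le_mul_of_rankOne (m := m) (u ε) hinj c hc C' (hC' _
    (Matrix.posSemidef_vecMulVec_self_star _) fun i j => by
      rw [mem_closedBall_zero_iff, Matrix.vecMulVec_apply, norm_mul, Pi.star_apply, norm_star,
        Complex.norm_real, Complex.norm_real]
      calc _ ≤ √ρ * √ρ := by gcongr <;> exact hle _
        _ = ρ := Real.mul_self_sqrt hρ.le)
  rw [sq] at hsq
  exact le_of_mul_le_mul_right hsq hεS
end
end

section
/- Let 0 < ρ ≤ ∞ and let f : D(0,ρ) → ℂ be analytic with f(x) real for x ∈ (0,ρ), so f(x) = Σ_{n≥0} c_n x^n with real coefficients c_n. If f[A] is positive semidefinite for every A ∈ 𝒫_N^1((0,ρ)) for some integer N ≥ 1, then the first N nonzero coefficients among the c_n (if they exist) are strictly positive. In particular, if f is a polynomial that is a sum of at most N monomials and f[−] preserves positivity on 𝒫_N^1((0,ρ)), then all coefficients of f are non-negative. -/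
open scoped ComplexOrder ENNReal

noncomputable section

/-- If a real power series is nonnegative on `(0, δ]`, then its first coefficient that may be
nonzero is nonnegative. -/
theorem leading_coeff_nonneg_of_hasSum_nonneg {b : ℕ → ℝ} {n : ℕ} {δ : ℝ} (hδ : 0 < δ)
    (hb : ∀ k < n, b k = 0)
    (h : ∀ x : ℝ, 0 < x → x ≤ δ → ∃ g : ℝ, 0 ≤ g ∧ HasSum (fun k => b k * x ^ k) g) :
    0 ≤ b n := by
  obtain ⟨_, -, h₀⟩ := h δ hδ le_rfl
  set M : ℝ := ∑' k, |b k * δ ^ k|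
  have hsum : Summable fun k => |b k * δ ^ k| := summable_abs_iff.2 h₀.summable
  have key : ∀ t : ℝ, 0 < t → t ≤ 1 → 0 ≤ b n * δ ^ n + t * M := by
    intro t ht ht1
    obtain ⟨g, hg0, hg⟩ := h (t * δ) (by positivity) (by nlinarith)
    have hg' : HasSum (fun k => if k = n then b n * (t * δ) ^ n else 0) (b n * (t * δ) ^ n) :=
      hasSum_ite_eq n _
    have hM : HasSum (fun k => t ^ (n + 1) * |b k * δ ^ k|) (t ^ (n + 1) * M) :=
      hsum.hasSum.mul_left _
    have hle : g - b n * (t * δ) ^ n ≤ t ^ (n + 1) * M := by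
      refine hasSum_le (fun k => ?_) (hg.sub hg') hM
      rcases lt_trichotomy k n with hk | rfl | hk
      · simp [hb k hk, hk.ne]
      · simp only [if_true, sub_self]
        positivity
      · have e : b k * (t * δ) ^ k = t ^ k * (b k * δ ^ k) := by rw [mul_pow]; ring
        rw [if_neg hk.ne', sub_zero, e]
        calc t ^ k * (b k * δ ^ k) ≤ t ^ k * |b k * δ ^ k| := by
              gcongr
              exact le_abs_self _
          _ ≤ t ^ (n + 1) * |b k * δ ^ k| := by
              gcongr ?_ * _
              exact pow_le_pow_of_le_one ht.le ht1 hk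
    have : 0 ≤ t ^ n * (b n * δ ^ n + t * M) := by
      have e : t ^ n * (b n * δ ^ n + t * M) = b n * (t * δ) ^ n + t ^ (n + 1) * M := by
        rw [mul_pow]; ring
      rw [e]
      linarith
    exact nonneg_of_mul_nonneg_right this (by positivity)
  have hlim : Filter.Tendsto (fun t : ℝ => b n * δ ^ n + t * M) (nhdsWithin 0 (Set.Ioi 0))
      (nhds (b n * δ ^ n)) := by
    have hc : Continuous fun t : ℝ => b n * δ ^ n + t * M := by fun_prop
    simpa using (hc.tendsto 0).mono_left nhdsWithin_le_nhds
  have hnn : 0 ≤ b n * δ ^ n := by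
    refine ge_of_tendsto hlim ?_
    filter_upwards [Ioc_mem_nhdsGT (zero_lt_one (α := ℝ))] with t ht using key t ht.1 ht.2
  exact nonneg_of_mul_nonneg_left hnn (by positivity)

/-- The geometric rank-one matrix `(x 2 ^ (i + j))`, `x ≥ 0`, is positive semidefinite of rank at
most one. -/
theorem posSemidef_rank_le_one_geometric (N : ℕ) {x : ℝ} (hx : 0 ≤ x) :
    (Matrix.of fun i j : Fin N => ((x * 2 ^ ((i : ℕ) + j) : ℝ) : ℂ)).PosSemidef ∧
      (Matrix.of fun i j : Fin N => ((x * 2 ^ ((i : ℕ) + j) : ℝ) : ℂ)).rank ≤ 1 := by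
  set w : Fin N → ℂ := fun i => ((√x * 2 ^ (i : ℕ) : ℝ) : ℂ)
  have e : (Matrix.of fun i j : Fin N => ((x * 2 ^ ((i : ℕ) + j) : ℝ) : ℂ)) =
      Matrix.vecMulVec w (star w) := by
    ext i j
    simp only [Matrix.of_apply, Matrix.vecMulVec_apply, w, Pi.star_apply, RCLike.star_def,
      Complex.conj_ofReal, ← Complex.ofReal_mul]
    congr 1
    rw [pow_add]
    nth_rewrite 1 [← Real.mul_self_sqrt hx]
    ring
  rw [e]
  exact ⟨Matrix.posSemidef_vecMulVec_self_star w, Matrix.rank_vecMulVec_le _ _⟩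

/-- The quadratic form of `p`'s coefficient vector on the matrix `f (x 2 ^ (i + j))` has
power series coefficients `a k * p (2 ^ k) ^ 2`. -/
theorem hasSum_quadraticForm_geometric {N : ℕ} {f : ℂ → ℂ} {a : ℕ → ℝ} {x : ℝ}
    (p : Polynomial ℝ) (hp : p.natDegree < N)
    (hf : ∀ i j : Fin N, HasSum
      (fun k : ℕ => (a k : ℂ) * ((x * 2 ^ ((i : ℕ) + j) : ℝ) : ℂ) ^ k)
      (f ((x * 2 ^ ((i : ℕ) + j) : ℝ) : ℂ))) :
    HasSum (fun k : ℕ => ((a k * p.eval (2 ^ k) ^ 2 * x ^ k : ℝ) : ℂ))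
      (∑ i : Fin N, ∑ j : Fin N, (p.coeff i : ℂ) *
        (f ((x * 2 ^ ((i : ℕ) + j) : ℝ) : ℂ) * (p.coeff j : ℂ))) := by
  have h := hasSum_sum (s := Finset.univ) fun (i : Fin N) _ =>
    hasSum_sum (s := Finset.univ) fun (j : Fin N) _ =>
      ((hf i j).mul_right (p.coeff j : ℂ)).mul_left (p.coeff i : ℂ)
  refine (congrArg (HasSum · _) (funext fun k => ?_)).mpr h
  rw [Polynomial.eval_eq_sum_range' hp, ← Fin.sum_univ_eq_sum_range
    (fun i => p.coeff i * (2 ^ k) ^ i), sq, Finset.sum_mul_sum]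
  push_cast
  simp only [Finset.mul_sum, Finset.sum_mul]
  refine Finset.sum_congr rfl fun i _ => Finset.sum_congr rfl fun j _ => ?_
  rw [mul_pow, ← pow_mul, ← pow_mul, ← pow_mul, add_mul, pow_add, mul_comm k, mul_comm k]
  ring

theorem stmt_7 (ρ : ℝ≥0∞) (hρ : 0 < ρ) (N : ℕ) (hN : 1 ≤ N)
    (f : ℂ → ℂ) (a : ℕ → ℝ)
    (hf : ∀ z ∈ EMetric.ball (0 : ℂ) ρ, HasSum (fun n : ℕ => (a n : ℂ) * z ^ n) (f z))
    (hpres : ∀ A : Matrix (Fin N) (Fin N) ℂ, A.PosSemidef → A.rank ≤ 1 →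
      (∀ i j, ∃ x : ℝ, 0 < x ∧ ENNReal.ofReal x < ρ ∧ A i j = (x : ℂ)) →
      (A.map f).PosSemidef) :
    (∀ n : ℕ, a n ≠ 0 → ({k | k < n ∧ a k ≠ 0} : Set ℕ).ncard < N → 0 < a n)
    ∧ (({n | a n ≠ 0} : Set ℕ).Finite → ({n | a n ≠ 0} : Set ℕ).ncard ≤ N →
        ∀ n, 0 ≤ a n) := by
  have main : ∀ n : ℕ, a n ≠ 0 → ({k | k < n ∧ a k ≠ 0} : Set ℕ).ncard < N → 0 < a n := by
    intro n hn hcard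
    set S : Finset ℕ := {k ∈ Finset.range n | a k ≠ 0} with hS
    have hSc : S.card < N := by
      rwa [show ({k | k < n ∧ a k ≠ 0} : Set ℕ) = S by ext; simp [hS],
        Set.ncard_coe_finset] at hcard
    set p : Polynomial ℝ := ∏ k ∈ S, (Polynomial.X - Polynomial.C (2 ^ k)) with hp
    have hpdeg : p.natDegree < N := by
      rwa [hp, Polynomial.natDegree_finsetProd_X_sub_C_eq_card]
    have hinj : Function.Injective fun k : ℕ => (2 : ℝ) ^ k :=
      pow_right_injective₀ (by norm_num) (by norm_num)
    have hpn : p.eval (2 ^ n) ≠ 0 := by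
      rw [hp, Polynomial.eval_prod, Finset.prod_ne_zero_iff]
      intro k hk
      have hkn : k < n := by simp [hS] at hk; exact hk.1
      simpa [sub_eq_zero] using fun h => hkn.ne (hinj h).symm
    have hpk : ∀ k < n, a k * p.eval (2 ^ k) ^ 2 = 0 := by
      intro k hk
      by_cases hak : a k = 0
      · simp [hak]
      · have : p.eval (2 ^ k) = 0 := by
          rw [hp, Polynomial.eval_prod]
          exact Finset.prod_eq_zero (i := k) (by simp [hS, hk, hak]) (by simp)
        simp [this]
    obtain ⟨r, hr0, hr⟩ := ENNReal.lt_iff_exists_nnreal_btwn.1 hρ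
    have hr0' : (0 : ℝ) < r := by exact_mod_cast hr0
    have hnn : 0 ≤ a n * p.eval (2 ^ n) ^ 2 := by
      refine leading_coeff_nonneg_of_hasSum_nonneg (δ := r / 4 ^ N)
        (b := fun k => a k * p.eval (2 ^ k) ^ 2) (by positivity) hpk fun x hx hxr => ?_
      have hent : ∀ i j : Fin N, ENNReal.ofReal (x * 2 ^ ((i : ℕ) + j)) < ρ := by
        intro i j
        refine lt_of_le_of_lt ?_ hr
        rw [← ENNReal.ofReal_coe_nnreal]
        refine ENNReal.ofReal_le_ofReal ?_
        have h4 : (2 : ℝ) ^ ((i : ℕ) + j) ≤ 4 ^ N := by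
          rw [show (4 : ℝ) = 2 ^ 2 by norm_num, ← pow_mul]
          exact pow_le_pow_right₀ (by norm_num) (by omega)
        calc x * 2 ^ ((i : ℕ) + j) ≤ r / 4 ^ N * 4 ^ N := by gcongr
          _ = r := by field_simp
      have hpos : ∀ i j : Fin N, 0 < x * 2 ^ ((i : ℕ) + j) := fun i j => by positivity
      have hsum := hasSum_quadraticForm_geometric (f := f) (a := a) (x := x) p hpdeg
        fun i j => hf _ (by
          change edist _ _ < ρ
          rw [edist_zero_right, ← ofReal_norm, Complex.norm_real,
            Real.norm_of_nonneg (hpos i j).le]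
          exact hent i j)
      obtain ⟨hA, hA1⟩ := posSemidef_rank_le_one_geometric N hx.le
      have hq := (hpres _ hA hA1 fun i j => ⟨_, hpos i j, hent i j, rfl⟩).dotProduct_mulVec_nonneg
        fun i => (p.coeff i : ℂ)
      have hq' : (0 : ℂ) ≤ ∑ i : Fin N, ∑ j : Fin N, (p.coeff i : ℂ) *
          (f ((x * 2 ^ ((i : ℕ) + j) : ℝ) : ℂ) * (p.coeff j : ℂ)) := by
        simpa [dotProduct, Matrix.mulVec, Finset.mul_sum] using hq
      exact ⟨_, (Complex.le_def.1 hq').1, by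
        simpa only [Complex.ofReal_re] using Complex.hasSum_re hsum⟩
    have : 0 ≤ a n := nonneg_of_mul_nonneg_left hnn (by positivity)
    exact lt_of_le_of_ne this hn.symm
  refine ⟨main, fun hfin hcard n => ?_⟩
  by_cases hn : a n = 0
  · exact hn.ge
  · refine (main n hn (lt_of_lt_of_le (Set.ncard_lt_ncard ?_ hfin) hcard)).le
    exact ⟨fun k hk => hk.2, fun h => lt_irrefl n (h hn).1⟩
end
end

section
/- Let 𝔽 be a field, N ≥ 1 an integer, and u = (u_1,…,u_N)ᵀ, v = (v_1,…,v_N)ᵀ ∈ 𝔽^N; set A := u vᵀ. Given integers 0 ≤ n_1 < n_2 < ⋯ < n_m and scalars c_{n_1}, …, c_{n_m} ∈ 𝔽, the following determinantal identity holds: det(Σ_{j=1}^m c_{n_j} A^{∘n_j}) = Σ_S (Π_{k∈S} c_{n_k}) · det(u_i^{n_k})_{i∈{1,…,N}, k∈S} · det(v_i^{n_k})_{i∈{1,…,N}, k∈S}, where S ranges over all subsets of {n_1,…,n_m} of cardinality N (with columns indexed by the elements of S in increasing order). In particular, if m < N the determinant is zero. -/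
noncomputable section

/-- Multilinear expansion of the determinant of a product of rectangular matrices. -/
theorem Matrix.det_mul_eq_sum_fun {R n ι : Type*} [CommRing R] [Fintype n] [DecidableEq n]
    [Fintype ι] (P : Matrix n ι R) (Q : Matrix ι n R) :
    (P * Q).det = ∑ f : n → ι, (∏ i, P i (f i)) * (Q.submatrix f id).det := by
  classical
  have h : P * Q = fun i => ∑ j, P i j • Q j := by
    ext i k
    simp [Matrix.mul_apply, Finset.sum_apply]
  rw [h]
  change Matrix.detRowAlternating.toMultilinearMap _ = _
  rw [MultilinearMap.map_sum]
  refine Finset.sum_congr rfl fun f _ => ?_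
  rw [MultilinearMap.map_smul_univ]
  rfl

/-- The **Cauchy–Binet formula**, with subsets encoded as strictly increasing maps. -/
theorem Matrix.det_mul_eq_sum_strictMono {R ι : Type*} [CommRing R] [Fintype ι] [LinearOrder ι]
    {N : ℕ} [DecidablePred (StrictMono : (Fin N → ι) → Prop)]
    (P : Matrix (Fin N) ι R) (Q : Matrix ι (Fin N) R) :
    (P * Q).det = ∑ s : Fin N → ι with StrictMono s,
      (P.submatrix id s).det * (Q.submatrix s id).det := by
  classical
  have hexpand (s : Fin N → ι) : (P.submatrix id s).det * (Q.submatrix s id).det =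
      ∑ σ : Equiv.Perm (Fin N),
        (∏ i, P i (s (σ i))) * (Q.submatrix (s ∘ σ) id).det := by
    rw [← Matrix.det_transpose, Matrix.det_apply', Finset.sum_mul]
    refine Finset.sum_congr rfl fun σ _ => ?_
    have h := Matrix.det_permute σ (Q.submatrix s id)
    rw [Matrix.submatrix_submatrix] at h
    rw [show (id : Fin N → Fin N) ∘ id = id from rfl] at h
    rw [h]
    simp only [Matrix.transpose_apply, Matrix.submatrix_apply, id]
    ring
  rw [Matrix.det_mul_eq_sum_fun, Finset.sum_congr rfl fun s _ => hexpand s,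
    ← Finset.sum_product', ← Finset.sum_filter_of_ne (p := Function.Injective)]
  · symm
    refine Finset.sum_bij (fun x _ => x.1 ∘ x.2) ?_ ?_ ?_ fun _ _ => rfl
    · rintro ⟨s, σ⟩ h
      simp only [Finset.mem_product, Finset.mem_filter, Finset.mem_univ, true_and,
        and_true] at h ⊢
      exact h.injective.comp σ.injective
    · rintro ⟨s, σ⟩ h ⟨t, τ⟩ h' he
      simp only [Finset.mem_product, Finset.mem_filter, Finset.mem_univ, true_and,
        and_true] at h h' he
      have hst : s = t := by
        rw [← h.range_inj h', ← σ.surjective.range_comp, he, τ.surjective.range_comp]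
      subst hst
      have : σ = τ := Equiv.ext fun i => h.injective (congrFun he i)
      rw [this]
    · intro f hf
      simp only [Finset.mem_filter, Finset.mem_univ, true_and] at hf
      refine ⟨(f ∘ Tuple.sort f, (Tuple.sort f)⁻¹), ?_, ?_⟩
      · simpa using (Tuple.monotone_sort f).strictMono_of_injective
          (hf.comp (Tuple.sort f).injective)
      · ext i
        simp
  · intro f _ hne
    by_contra hf
    obtain ⟨i, j, hij, hne'⟩ := Function.not_injective_iff.mp hf
    refine hne ?_
    rw [Matrix.det_zero_of_row_eq hne' (by ext k; simp [hij]), mul_zero]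

theorem stmt_8 (𝔽 : Type*) [Field 𝔽] (N m : ℕ) (hN : 1 ≤ N)
    (u v : Fin N → 𝔽) (n : Fin m → ℕ) (hn : StrictMono n) (c : Fin m → 𝔽) :
    ((∑ j : Fin m, c j • Matrix.of fun i k : Fin N => (u i * v k) ^ n j).det
      = ∑ s ∈ Finset.univ.filter (fun s : Fin N → Fin m => ∀ i j : Fin N, i < j → s i < s j),
          (∏ k : Fin N, c (s k))
            * (Matrix.of fun i k : Fin N => u i ^ n (s k)).det
            * (Matrix.of fun i k : Fin N => v i ^ n (s k)).det)
    ∧ (m < N →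
        (∑ j : Fin m, c j • Matrix.of fun i k : Fin N => (u i * v k) ^ n j).det = 0) := by
  classical
  have hfactor : (∑ j : Fin m, c j • Matrix.of fun i k : Fin N => (u i * v k) ^ n j) =
      (Matrix.of fun i j => c j * u i ^ n j) * (Matrix.of fun j k => v k ^ n j) := by
    ext i k
    simp [Matrix.mul_apply, Matrix.sum_apply, mul_pow, mul_assoc]
  rw [hfactor, Matrix.det_mul_eq_sum_strictMono]
  constructor
  · refine Finset.sum_congr (Finset.filter_congr fun s _ => Iff.rfl) fun s _ => ?_
    congr 1
    · exact Matrix.det_mul_row (fun k => c (s k)) (Matrix.of fun i k => u i ^ n (s k))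
    · exact Matrix.det_transpose (Matrix.of fun i k => v i ^ n (s k))
  · intro hmN
    refine Finset.sum_eq_zero fun s hs => absurd ?_ hmN.not_ge
    simpa using Fintype.card_le_of_injective s (Finset.mem_filter.mp hs).2.injective
end
end

section
/- Let 𝔽 be a field, let R ≥ 0 and M ≥ N ≥ 1 be integers, let c_0, …, c_{N−1} ∈ 𝔽 be nonzero, and let p_t(x) := t(c_0 x^R + c_1 x^{R+1} + ⋯ + c_{N−1} x^{R+N−1}) − x^{R+M}, where t is an indeterminate. Then for all u = (u_1,…,u_N), v = (v_1,…,v_N) ∈ 𝔽^N, the following polynomial identity in t holds: det p_t[u vᵀ] = t^{N−1} · Δ_N(u) · Δ_N(v) · Π_{j=1}^N c_{j−1} u_j^R v_j^R · (t − Σ_{j=0}^{N−1} s_{μ(M,N,j)}(u) · s_{μ(M,N,j)}(v) / c_j). -/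
noncomputable section

open MvPolynomial

/-- The Vandermonde determinant `Δ_N(x) = det(x_i^{N-j})`. -/
def vand {𝔽 : Type*} [CommRing 𝔽] (N : ℕ) (x : Fin N → 𝔽) : 𝔽 :=
  (Matrix.of fun i k : Fin N => x i ^ (N - 1 - (k : ℕ))).det

/-- The hook partition `μ(M,N,j) = (M−N+1, 1, …, 1, 0, …, 0)` with `N−j−1` ones after the
first entry and `j` trailing zeros (indexed from 0). -/
def hookMu (M N j : ℕ) (k : Fin N) : ℕ :=
  if (k : ℕ) = 0 then M - N + 1 else if (k : ℕ) < N - j then 1 else 0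

/-- `S` is the Schur polynomial of the partition `lam` (with at most `N` parts):
the unique polynomial with `S · Δ_N(x) = det(x_i^{lam_j + N − j})`. -/
def IsSchur {𝔽 : Type*} [CommRing 𝔽] (N : ℕ) (lam : Fin N → ℕ)
    (S : MvPolynomial (Fin N) 𝔽) : Prop :=
  S * (Matrix.of fun i k : Fin N => (X i : MvPolynomial (Fin N) 𝔽) ^ (N - 1 - (k : ℕ))).det
    = (Matrix.of fun i k : Fin N =>
        (X i : MvPolynomial (Fin N) 𝔽) ^ (lam k + (N - 1 - (k : ℕ)))).det

theorem det_submatrix_mul_det_submatrix {n R : Type*} [Fintype n] [DecidableEq n] [CommRing R]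
    (A B : Matrix n n R) (σ : Equiv.Perm n) :
    (A.submatrix id σ).det * (B.submatrix id σ).det = A.det * B.det := by
  have h : ((Equiv.Perm.sign σ : ℤ) : R) * ((Equiv.Perm.sign σ : ℤ) : R) = 1 := by
    rw [← Int.cast_mul, ← Units.val_mul, Int.units_mul_self]; simp
  rw [Matrix.det_permute', Matrix.det_permute']
  linear_combination A.det * B.det * h

/-- Sorting the exponents of the bialternant of the hook `μ(M,N,j)`: the power `M` sits in
column `j` and every other column `k` carries its own power `k`. -/
theorem exists_perm_hookMu_exponent {M N : ℕ} (hM : N ≤ M) (j : Fin N) :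
    ∃ σ : Equiv.Perm (Fin N), ∀ k : Fin N,
      hookMu M N (j : ℕ) k + (N - 1 - (k : ℕ)) = if σ k = j then M else (σ k : ℕ) := by
  let f : Fin N → Fin N := fun k =>
    if h : (k : ℕ) = 0 then j
    else if (k : ℕ) < N - j then ⟨N - k, by omega⟩
    else ⟨N - 1 - k, by omega⟩
  have hf : Function.Injective f := by
    intro a b h
    simp only [f] at h
    split_ifs at h <;> simp only [Fin.ext_iff] at h ⊢ <;> omega
  refine ⟨Equiv.ofBijective f (Finite.injective_iff_bijective.mp hf), fun k => ?_⟩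
  have hj := j.isLt
  have hk := k.isLt
  rw [Equiv.ofBijective_apply, hookMu]
  by_cases h₀ : (k : ℕ) = 0
  · simp only [f, h₀, dite_true, if_true]
    omega
  by_cases h₁ : (k : ℕ) < N - j
  · have hfk : (f k : ℕ) = N - k := by simp [f, h₀, h₁]
    rw [if_neg h₀, if_pos h₁, if_neg (by rw [Fin.ext_iff, hfk]; omega), hfk]
    omega
  · have hfk : (f k : ℕ) = N - 1 - k := by simp [f, h₀, h₁]
    rw [if_neg h₀, if_neg h₁, if_neg (by rw [Fin.ext_iff, hfk]; omega), hfk, zero_add]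

theorem vand_mul_vand {R : Type*} [CommRing R] (N : ℕ) (u v : Fin N → R) :
    vand N u * vand N v = (Matrix.vandermonde u).det * (Matrix.vandermonde v).det := by
  rw [← det_submatrix_mul_det_submatrix _ _ Fin.revPerm]
  have h : ∀ w : Fin N → R, vand N w = ((Matrix.vandermonde w).submatrix id Fin.revPerm).det := by
    intro w
    unfold vand
    congr 1
    ext i k
    simp only [Matrix.of_apply, Matrix.submatrix_apply, id, Matrix.vandermonde_apply,
      Fin.revPerm_apply, Fin.val_rev]
    congr 1
    omega
  rw [h, h]

theorem IsSchur.eval_mul_vand {R : Type*} [CommRing R] {N : ℕ} {lam : Fin N → ℕ}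
    {S : MvPolynomial (Fin N) R} (hS : IsSchur N lam S) (u : Fin N → R) :
    MvPolynomial.eval u S * vand N u
      = (Matrix.of fun i k : Fin N => u i ^ (lam k + (N - 1 - (k : ℕ)))).det := by
  have h := congrArg (MvPolynomial.eval u) hS
  rw [map_mul, RingHom.map_det, RingHom.map_det] at h
  convert h using 2
  · unfold vand
    congr 1
    ext i k
    simp
  · ext i k
    simp

theorem IsSchur.eval_mul_eval_hookMu {R : Type*} [CommRing R] {M N : ℕ} (hM : N ≤ M) {j : Fin N}
    {S : MvPolynomial (Fin N) R} (hS : IsSchur N (hookMu M N (j : ℕ)) S) (u v : Fin N → R) :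
    (MvPolynomial.eval u S * vand N u) * (MvPolynomial.eval v S * vand N v)
      = (Matrix.vandermonde u).cramer (fun i => u i ^ M) j
        * (Matrix.vandermonde v).cramer (fun i => v i ^ M) j := by
  obtain ⟨σ, hσ⟩ := exists_perm_hookMu_exponent hM j
  rw [hS.eval_mul_vand, hS.eval_mul_vand, Matrix.cramer_apply, Matrix.cramer_apply,
    ← det_submatrix_mul_det_submatrix ((Matrix.vandermonde u).updateCol j _) _ σ]
  have h : ∀ w : Fin N → R,
      (Matrix.of fun i k : Fin N => w i ^ (hookMu M N (j : ℕ) k + (N - 1 - (k : ℕ))))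
        = ((Matrix.vandermonde w).updateCol j fun i => w i ^ M).submatrix id σ := by
    intro w
    ext i k
    simp only [Matrix.of_apply, hσ, Matrix.submatrix_apply, id, Matrix.updateCol_apply,
      Matrix.vandermonde_apply]
    split_ifs <;> rfl
  rw [h, h]

/-- A rank-one update of a scaled diagonal matrix. -/
theorem det_X_mul_diagonal_sub_vecMulVec {n K : Type*} [Fintype n] [DecidableEq n] [Nonempty n]
    [Field K] (c a b : n → K) (hc : ∀ j, c j ≠ 0) :
    (Matrix.of fun i k : n => Polynomial.X * Polynomial.C (Matrix.diagonal c i k)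
        - Polynomial.C (a i * b k)).det
      = Polynomial.X ^ (Fintype.card n - 1) * Polynomial.C (∏ j, c j)
        * (Polynomial.X - Polynomial.C (∑ j, a j * b j / c j)) := by
  have h : (Matrix.of fun i k : n => Polynomial.X * Polynomial.C (Matrix.diagonal c i k)
        - Polynomial.C (a i * b k))
      = Matrix.of fun i k => Polynomial.C (c i)
        * (Matrix.vecMulVec (fun i => a i / c i) b).charmatrix i k := by
    ext1 i k
    have hab : c i * (a i / c i * b k) = a i * b k := by
      rw [div_mul_eq_mul_div, mul_div_cancel₀ _ (hc i)]
    simp only [Matrix.of_apply, Matrix.charmatrix_apply, Matrix.vecMulVec_apply, mul_sub,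
      ← Polynomial.C_mul, hab]
    by_cases hik : i = k
    · subst hik
      simp only [Matrix.diagonal_apply_eq]
      ring
    · simp [hik]
  have hcard : Polynomial.X ^ Fintype.card n
      = (Polynomial.X : Polynomial K) ^ (Fintype.card n - 1) * Polynomial.X := by
    rw [← pow_succ, Nat.sub_add_cancel Fintype.card_pos]
  have hdot : (fun i => a i / c i) ⬝ᵥ b = ∑ j, a j * b j / c j := by
    simp only [dotProduct]
    exact Finset.sum_congr rfl fun j _ => by ring
  rw [h, Matrix.det_mul_column, ← Matrix.charpoly, Matrix.charpoly_vecMulVec, hdot, hcard,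
    map_prod, Polynomial.smul_eq_C_mul]
  ring

theorem vand_eq_zero_of_not_injective {R : Type*} [CommRing R] {N : ℕ} {u : Fin N → R}
    (hu : ¬ Function.Injective u) : vand N u = 0 := by
  simp only [Function.Injective, not_forall] at hu
  obtain ⟨i, k, h, hik⟩ := hu
  exact Matrix.det_zero_of_row_eq hik (by ext; simp [h])

theorem stmt_9 (𝔽 : Type*) [Field 𝔽] (R M N : ℕ) (hN : 1 ≤ N) (hM : N ≤ M)
    (c : Fin N → 𝔽) (hc : ∀ j, c j ≠ 0)
    (S : Fin N → MvPolynomial (Fin N) 𝔽)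
    (hS : ∀ j : Fin N, IsSchur N (hookMu M N (j : ℕ)) (S j))
    (u v : Fin N → 𝔽) :
    (Matrix.of fun i k : Fin N =>
        Polynomial.X * Polynomial.C (∑ j : Fin N, c j * (u i * v k) ^ (R + (j : ℕ)))
          - Polynomial.C ((u i * v k) ^ (R + M))).det
      = Polynomial.X ^ (N - 1)
          * Polynomial.C (vand N u * vand N v * ∏ j : Fin N, c j * u j ^ R * v j ^ R)
          * (Polynomial.X - Polynomial.C (∑ j : Fin N,
              MvPolynomial.eval u (S j) * MvPolynomial.eval v (S j) / c j)) := by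
  by_cases hu : Function.Injective u
  swap
  · rw [vand_eq_zero_of_not_injective hu]
    simp only [Function.Injective, not_forall] at hu
    obtain ⟨i, k, h, hik⟩ := hu
    rw [Matrix.det_zero_of_row_eq hik (by ext1; simp [h])]
    simp
  by_cases hv : Function.Injective v
  swap
  · rw [vand_eq_zero_of_not_injective hv]
    simp only [Function.Injective, not_forall] at hv
    obtain ⟨i, k, h, hik⟩ := hv
    rw [Matrix.det_zero_of_column_eq hik (by intro; simp [h])]
    simp
  have hU := Matrix.det_vandermonde_ne_zero_iff.mpr hu
  have hV := Matrix.det_vandermonde_ne_zero_iff.mpr hv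
  have hne : Nonempty (Fin N) := ⟨⟨0, hN⟩⟩
  set U := Matrix.vandermonde u with hUdef
  set V := Matrix.vandermonde v with hVdef
  let a : Fin N → 𝔽 := fun j => U.cramer (fun i => u i ^ M) j / U.det
  let b : Fin N → 𝔽 := fun j => V.cramer (fun i => v i ^ M) j / V.det
  have expand : ∀ w : Fin N → 𝔽, (Matrix.vandermonde w).det ≠ 0 → ∀ i, w i ^ M =
      ∑ j : Fin N, w i ^ (j : ℕ) * ((Matrix.vandermonde w).cramer (fun i => w i ^ M) j
        / (Matrix.vandermonde w).det) := by
    intro w hw i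
    have h := congrFun (Matrix.mulVec_cramer (Matrix.vandermonde w) fun i => w i ^ M) i
    simp only [Matrix.mulVec, dotProduct, Matrix.vandermonde_apply, Pi.smul_apply,
      smul_eq_mul] at h
    simp only [← mul_div_assoc, ← Finset.sum_div]
    rw [h, mul_div_cancel_left₀ _ hw]
  have hsum : ∑ j : Fin N, MvPolynomial.eval u (S j) * MvPolynomial.eval v (S j) / c j
      = ∑ j, a j * b j / c j := by
    refine Finset.sum_congr rfl fun j _ => ?_
    have h := (hS j).eval_mul_eval_hookMu hM u v
    have hW := vand_mul_vand N u v
    congr 1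
    simp only [a, b]
    rw [div_mul_div_comm, eq_div_iff (mul_ne_zero hU hV), ← h, ← hW]
    ring
  have hfactor : (Matrix.of fun i k : Fin N =>
        Polynomial.X * Polynomial.C (∑ j : Fin N, c j * (u i * v k) ^ (R + (j : ℕ)))
          - Polynomial.C ((u i * v k) ^ (R + M)))
      = Matrix.of fun i k => Polynomial.C (u i ^ R) * (Matrix.of fun i k =>
          Polynomial.C (v k ^ R) * (U.map Polynomial.C * (Matrix.of fun i k : Fin N =>
            Polynomial.X * Polynomial.C (Matrix.diagonal c i k) - Polynomial.C (a i * b k))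
            * (V.map Polynomial.C).transpose : Matrix (Fin N) (Fin N) (Polynomial 𝔽)) i k) i k := by
    ext1 i k
    have hUa := expand u hU i
    have hVb := expand v hV k
    have hmid : (U.map Polynomial.C * (Matrix.of fun i k : Fin N =>
            Polynomial.X * Polynomial.C (Matrix.diagonal c i k) - Polynomial.C (a i * b k))
            * (V.map Polynomial.C).transpose : Matrix (Fin N) (Fin N) (Polynomial 𝔽)) i k
        = Polynomial.X * Polynomial.C (∑ j : Fin N, c j * (u i * v k) ^ (j : ℕ))
          - Polynomial.C ((u i * v k) ^ M) := by
      have hsplit : (Matrix.of fun i k : Fin N =>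
            Polynomial.X * Polynomial.C (Matrix.diagonal c i k) - Polynomial.C (a i * b k))
          = Matrix.diagonal (fun j => Polynomial.X * Polynomial.C (c j))
            - Matrix.vecMulVec (fun j => Polynomial.C (a j)) (fun j => Polynomial.C (b j)) := by
        ext1 p q
        by_cases hpq : p = q
        · subst hpq; simp [Matrix.vecMulVec_apply]
        · simp [Matrix.vecMulVec_apply, hpq]
      rw [hsplit, Matrix.mul_sub, Matrix.sub_mul, Matrix.sub_apply, Matrix.mul_vecMulVec,
        Matrix.vecMulVec_mul, Matrix.vecMulVec_apply]
      congr 1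
      · rw [Matrix.mul_apply, map_sum, Finset.mul_sum]
        refine Finset.sum_congr rfl fun j _ => ?_
        simp only [Matrix.mul_diagonal, Matrix.map_apply, Matrix.transpose_apply, hUdef, hVdef,
          Matrix.vandermonde_apply, map_mul, map_pow, mul_pow]
        ring
      · rw [mul_pow, hUa, hVb, map_mul, map_sum, map_sum]
        congr 1
        · simp [Matrix.mulVec, dotProduct, hUdef, a]
        · simp [Matrix.vecMul, dotProduct, hVdef, b, mul_comm]
    simp only [Matrix.of_apply] at hmid ⊢
    rw [hmid, mul_pow _ _ (R + M), mul_sub, mul_sub]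
    congr 1
    · simp only [map_sum, Finset.mul_sum]
      refine Finset.sum_congr rfl fun j _ => ?_
      simp only [map_mul, map_pow, mul_pow, pow_add]
      ring
    · simp only [map_mul, map_pow, mul_pow, pow_add]
      ring
  rw [hfactor, Matrix.det_mul_column, Matrix.det_mul_row, Matrix.det_mul, Matrix.det_mul,
    Matrix.det_transpose, det_X_mul_diagonal_sub_vecMulVec c a b hc, hsum, vand_mul_vand,
    Fintype.card_fin, ← RingHom.mapMatrix_apply, ← RingHom.mapMatrix_apply, ← RingHom.map_det,
    ← RingHom.map_det]
  simp only [Finset.prod_mul_distrib, map_mul, map_prod]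
  ring
end
end
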